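/- Let X be the self-repelling random walk with directed edges and weight function w. Fix x ∈ ℝ and h > 0. Then, as A → ∞, A⁻²·T±_{⌊Ax⌋,⌊Ah⌋} → (|x| + 2h)² in probability. -/

import Mathlib

open MeasureTheory Filter
open scoped BigOperators ENNReal Topology

noncomputable section

/-- The weight function `w` is positive, nondecreasing and satisfies
`lim_{z→∞} (w(z) - w(-z)) > 0`. -/
def GoodWeight (w : ℤ → ℝ) : Prop :=
  (∀ z, 0 < w z) ∧ (∀ z, w z ≤ w (z + 1)) ∧
    ∃ c > (0 : ℝ), ∀ᶠ z : ℤ in atTop, c ≤ w z - w (-z)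

/-- Local time of the path `x` on the oriented edge from `k` to `k+1` up to time `n`. -/
def dirLocP (x : ℕ → ℤ) (n : ℕ) (k : ℤ) : ℕ :=
  ((Finset.range n).filter fun j => x j = k ∧ x (j + 1) = k + 1).card

/-- Local time of the path `x` on the oriented edge from `k` to `k-1` up to time `n`. -/
def dirLocM (x : ℕ → ℤ) (n : ℕ) (k : ℤ) : ℕ :=
  ((Finset.range n).filter fun j => x j = k ∧ x (j + 1) = k - 1).card

/-- The conditional probability, given the past path `x` up to time `n`, that the
self-repelling walk with weight `w` makes the step `x n → x (n+1)`. -/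
def stepProb (w : ℤ → ℝ) (x : ℕ → ℤ) (n : ℕ) : ℝ :=
  let Δ : ℤ := (dirLocP x n (x n) : ℤ) - (dirLocM x n (x n) : ℤ)
  if x (n + 1) = x n + 1 then w (-Δ) / (w Δ + w (-Δ))
  else if x (n + 1) = x n - 1 then w Δ / (w Δ + w (-Δ))
  else 0

/-- `X` is the self-repelling random walk with directed edges and weight function `w`:
it starts at `0` and its cylinder probabilities evolve by the self-repelling
transition probabilities. -/
def IsSRW {Ω : Type*} [MeasurableSpace Ω] (μ : Measure Ω) (w : ℤ → ℝ)
    (X : ℕ → Ω → ℤ) : Prop :=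
  (∀ n, Measurable (X n)) ∧
  μ {ω | X 0 ω = 0} = 1 ∧
  ∀ (n : ℕ) (x : ℕ → ℤ),
    μ {ω | ∀ i ≤ n + 1, X i ω = x i} =
      μ {ω | ∀ i ≤ n, X i ω = x i} * ENNReal.ofReal (stepProb w x n)

/-- Inverse local time `T⁺_{j,r} = min{n ≥ 0 : ℓ⁺(n,j) ≥ r}` of the path `x`. -/
def Tp (x : ℕ → ℤ) (j : ℤ) (r : ℕ) : ℕ := sInf {n | r ≤ dirLocP x n j}

/-- Inverse local time `T⁻_{j,r} = min{n ≥ 0 : ℓ⁻(n,j) ≥ r}` of the path `x`. -/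
def Tm (x : ℕ → ℤ) (j : ℤ) (r : ℕ) : ℕ := sInf {n | r ≤ dirLocM x n j}

/-- `Λ⁺_{j,r}(k) = ℓ⁺(T⁺_{j,r},k) + ℓ⁻(T⁺_{j,r},k+1)`. -/
def LamP (x : ℕ → ℤ) (j : ℤ) (r : ℕ) (k : ℤ) : ℕ :=
  dirLocP x (Tp x j r) k + dirLocM x (Tp x j r) (k + 1)

/-- `Λ⁻_{j,r}(k) = ℓ⁺(T⁻_{j,r},k) + ℓ⁻(T⁻_{j,r},k+1)`. -/
def LamM (x : ℕ → ℤ) (j : ℤ) (r : ℕ) (k : ℤ) : ℕ :=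
  dirLocP x (Tm x j r) k + dirLocM x (Tm x j r) (k + 1)

/-- Leftmost edge `λ⁺_{j,r}` visited before `T⁺_{j,r}`. -/
def lamEdgeP (x : ℕ → ℤ) (j : ℤ) (r : ℕ) : ℤ := sInf {k : ℤ | 0 < LamP x j r k}

/-- Leftmost edge `λ⁻_{j,r}` visited before `T⁻_{j,r}`. -/
def lamEdgeM (x : ℕ → ℤ) (j : ℤ) (r : ℕ) : ℤ := sInf {k : ℤ | 0 < LamM x j r k}

/-- Rightmost edge `ρ⁺_{j,r}` visited before `T⁺_{j,r}`. -/
def rhoEdgeP (x : ℕ → ℤ) (j : ℤ) (r : ℕ) : ℤ := sSup {k : ℤ | 0 < LamP x j r k}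

/-- Rightmost edge `ρ⁻_{j,r}` visited before `T⁻_{j,r}`. -/
def rhoEdgeM (x : ℕ → ℤ) (j : ℤ) (r : ℕ) : ℤ := sSup {k : ℤ | 0 < LamM x j r k}

/-- Probability that a site with local-time difference `z` sends the walk to the right. -/
def upProb (w : ℤ → ℝ) (z : ℤ) : ℝ := w (-z) / (w z + w (-z))

lemma upProb_pos {w : ℤ → ℝ} (hw : ∀ z, 0 < w z) (z : ℤ) : 0 < upProb w z :=
  div_pos (hw _) (add_pos (hw _) (hw _))

lemma upProb_add_neg {w : ℤ → ℝ} (hw : ∀ z, 0 < w z) (z : ℤ) :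
    upProb w z + upProb w (-z) = 1 := by
  have h1 := hw z
  have h2 := hw (-z)
  unfold upProb
  rw [neg_neg]
  field_simp
  ring

/-- Tail probabilities of the difference chain of a single site: for `s ≡ n` modulo `2`
this is the probability that the difference after `n` departures is at least `s`. -/
def tailRec (w : ℤ → ℝ) : ℕ → ℤ → ℝ
  | 0, s => if s ≤ 0 then 1 else 0
  | n + 1, s => upProb w (1 - s) * tailRec w n (s + 1) + upProb w (s - 1) * tailRec w n (s - 1)

lemma upProb_one_sub {w : ℤ → ℝ} (hw : ∀ z, 0 < w z) (s : ℤ) :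
    upProb w (1 - s) = 1 - upProb w (s - 1) := by
  have := upProb_add_neg hw (s - 1)
  rw [neg_sub] at this
  linarith

lemma tailRec_nonneg {w : ℤ → ℝ} (hw : ∀ z, 0 < w z) (n : ℕ) (s : ℤ) : 0 ≤ tailRec w n s := by
  induction n generalizing s with
  | zero => unfold tailRec; split_ifs <;> norm_num
  | succ n ih =>
    unfold tailRec
    have h1 := upProb_pos hw (1 - s)
    have h2 := upProb_pos hw (s - 1)
    have := ih (s + 1)
    have := ih (s - 1)
    positivity

lemma tailRec_le_one {w : ℤ → ℝ} (hw : ∀ z, 0 < w z) (n : ℕ) (s : ℤ) : tailRec w n s ≤ 1 := by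
  induction n generalizing s with
  | zero => unfold tailRec; split_ifs <;> norm_num
  | succ n ih =>
    unfold tailRec
    have h1 := upProb_pos hw (1 - s)
    have h2 := upProb_pos hw (s - 1)
    have h3 := upProb_one_sub hw s
    have := ih (s + 1)
    have := ih (s - 1)
    nlinarith

lemma tailRec_eq_zero {w : ℤ → ℝ} (n : ℕ) (s : ℤ) (hs : (n : ℤ) < s) : tailRec w n s = 0 := by
  induction n generalizing s with
  | zero => unfold tailRec; rw [if_neg]; push_cast at hs; omega
  | succ n ih =>
    unfold tailRec
    push_cast at hs
    rw [ih _ (by omega), ih _ (by omega)]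
    ring

lemma tailRec_symm {w : ℤ → ℝ} (hw : ∀ z, 0 < w z) (n : ℕ) (s : ℤ) (hs : Even (s - n)) :
    tailRec w n s + tailRec w n (2 - s) = 1 := by
  induction n generalizing s with
  | zero =>
    obtain ⟨k, hk⟩ := hs
    push_cast at hk
    unfold tailRec
    split_ifs <;> first | omega | norm_num
  | succ n ih =>
    obtain ⟨k, hk⟩ := hs
    push_cast at hk
    unfold tailRec
    have e1 := ih (s + 1) ⟨k + 1, by omega⟩
    have e2 := ih (s - 1) ⟨k, by omega⟩
    have h3 := upProb_one_sub hw s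
    have e4 : upProb w (1 - (2 - s)) = upProb w (s - 1) := by congr 1; ring
    have e5 : upProb w (2 - s - 1) = upProb w (1 - s) := by congr 1; ring
    have e6 : (2 : ℤ) - s + 1 = 2 - (s - 1) := by ring
    have e7 : (2 : ℤ) - s - 1 = 2 - (s + 1) := by ring
    rw [e4, e5, e6, e7]
    have f1 : tailRec w n (2 - (s + 1)) = 1 - tailRec w n (s + 1) := by linarith
    have f2 : tailRec w n (2 - (s - 1)) = 1 - tailRec w n (s - 1) := by linarith
    rw [f1, f2, h3]
    ring

lemma tailRec_one {w : ℤ → ℝ} (hw : ∀ z, 0 < w z) (n : ℕ) (hn : Odd n) :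
    tailRec w n 1 = 1 / 2 := by
  obtain ⟨k, hk⟩ := hn
  have := tailRec_symm hw n 1 ⟨-k, by push_cast [hk]; ring⟩
  norm_num at this
  linarith

lemma tailRec_mono_two {w : ℤ → ℝ} (hw : ∀ z, 0 < w z) (n : ℕ) (s : ℤ) (hs : Even (s - n))
    (h1 : 1 ≤ s) : tailRec w n s ≤ tailRec w (n + 2) s := by
  induction n generalizing s with
  | zero =>
    rw [tailRec_eq_zero 0 s (by push_cast; omega)]
    exact tailRec_nonneg hw _ _
  | succ n ih =>
    obtain ⟨k, hk⟩ := hs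
    push_cast at hk
    rcases h1.eq_or_lt with rfl | h1
    · rw [tailRec_one hw _ (by rw [← Nat.not_even_iff_odd]; rintro ⟨a, ha⟩; omega),
        tailRec_one hw _ (by rw [← Nat.not_even_iff_odd]; rintro ⟨a, ha⟩; omega)]
    · have e1 := ih (s + 1) ⟨k + 1, by omega⟩ (by omega)
      have e2 := ih (s - 1) ⟨k, by omega⟩ (by omega)
      rw [show n + 1 + 2 = (n + 2) + 1 by ring]
      conv_lhs => unfold tailRec
      conv_rhs => unfold tailRec
      have h1 := upProb_pos hw (1 - s)
      have h2 := upProb_pos hw (s - 1)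
      gcongr

lemma tailRec_mono {w : ℤ → ℝ} (hw : ∀ z, 0 < w z) (n j : ℕ) (s : ℤ) (hs : Even (s - n))
    (h1 : 1 ≤ s) : tailRec w n s ≤ tailRec w (n + 2 * j) s := by
  induction j with
  | zero => simp
  | succ j ih =>
    refine ih.trans ?_
    rw [show n + 2 * (j + 1) = (n + 2 * j) + 2 by ring]
    apply tailRec_mono_two hw _ _ _ h1
    obtain ⟨k, hk⟩ := hs
    exact ⟨k - j, by push_cast; omega⟩

lemma exists_geometric_upProb {w : ℤ → ℝ} (hw : GoodWeight w) :
    ∃ θ : ℝ, 0 < θ ∧ θ < 1 ∧ ∃ z₀ : ℕ, ∀ z : ℤ, z₀ ≤ z →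
      upProb w z ≤ θ * upProb w (-z) := by
  obtain ⟨hpos, hmono, c, hc, hev⟩ := hw
  obtain ⟨z₁, hz₁⟩ := eventually_atTop.1 hev
  have hm : Monotone w := monotone_int_of_le_succ hmono
  refine ⟨w 0 / (w 0 + c), by have := hpos 0; positivity, ?_, z₁.toNat, fun z hz => ?_⟩
  · rw [div_lt_one (by have := hpos 0; positivity)]; linarith
  · have h0 := hpos 0
    have h1 := hz₁ z (by omega)
    have h2 : w (-z) ≤ w 0 := hm (by omega)
    have h3 := hpos z
    have h4 := hpos (-z)
    unfold upProb
    rw [neg_neg, add_comm (w (-z)) (w z), ← mul_div_assoc]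
    gcongr
    rw [div_mul_eq_mul_div, le_div_iff₀ (by positivity)]
    nlinarith

lemma exists_tailRec_le {w : ℤ → ℝ} (hw : GoodWeight w) :
    ∃ θ : ℝ, 0 < θ ∧ θ < 1 ∧ ∃ C : ℝ, 0 < C ∧ ∀ (n s : ℕ), tailRec w n s ≤ C * θ ^ s := by
  obtain ⟨θ, h0, h1, z₀, hz⟩ := exists_geometric_upProb hw
  refine ⟨θ, h0, h1, (θ ^ (z₀ + 1))⁻¹, by positivity, fun n => ?_⟩
  induction n with
  | zero =>
    intro s
    have hs := tailRec_le_one hw.1 0 s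
    rcases Nat.eq_zero_or_pos s with rfl | h
    · refine hs.trans ?_
      rw [pow_zero, mul_one]
      exact (one_le_inv₀ (by positivity)).2 (pow_le_one₀ h0.le h1.le)
    · rw [tailRec_eq_zero 0 s (by exact_mod_cast h)]
      positivity
  | succ n ih =>
    intro s
    rcases le_or_gt s (z₀ + 1) with h | h
    · refine (tailRec_le_one hw.1 _ _).trans ?_
      rw [inv_mul_eq_div, one_le_div (by positivity)]
      exact pow_le_pow_of_le_one h0.le h1.le h
    · obtain ⟨t, rfl⟩ : ∃ t, s = t + 1 := ⟨s - 1, by omega⟩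
      unfold tailRec
      have e1 := ih (t + 2)
      have e2 := ih t
      have e3 := hz t (by exact_mod_cast (by omega : z₀ ≤ t))
      have e4 : (1 : ℤ) - ((t + 1 : ℕ) : ℤ) = -(t : ℤ) := by push_cast; ring
      have e5 : ((t + 1 : ℕ) : ℤ) - 1 = (t : ℤ) := by push_cast; ring
      have e6 : ((t + 1 : ℕ) : ℤ) + 1 = ((t + 2 : ℕ) : ℤ) := by push_cast; ring
      rw [e4, e5, e6]
      have p1 := upProb_pos hw.1 t
      have p2 := upProb_pos hw.1 (-t)
      have p3 := upProb_add_neg hw.1 t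
      set C := (θ ^ (z₀ + 1))⁻¹
      have hC : 0 < C := by positivity
      have hθ : 0 < θ ^ t := by positivity
      calc _ ≤ upProb w (-t) * (C * θ ^ (t + 2)) + upProb w t * (C * θ ^ t) := by gcongr
        _ = C * θ ^ t * (upProb w (-t) * θ ^ 2 + upProb w t) := by ring
        _ ≤ C * θ ^ t * θ := by
          gcongr
          nlinarith
        _ = _ := by ring

/-- The first `n` letters of a stack of instructions. -/
def steps (s : ℕ → Bool) (n : ℕ) : List Bool := (List.range n).map s

/-- Number of `true` letters minus number of `false` letters. -/
def excess (l : List Bool) : ℤ := (l.count true : ℤ) - l.count false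

/-- Stacks of instructions starting with the word `l`. -/
def stackCyl (l : List Bool) : Set (ℕ → Bool) := {s | steps s l.length = l}

/-- Conditional probability of the letter `b` after the word `l`. -/
def letterProb (w : ℤ → ℝ) (l : List Bool) (b : Bool) : ℝ :=
  if b then upProb w (excess l) else upProb w (-excess l)

/-- `P` is the law of the sequence of departure directions at a single site. -/
def IsStackLaw (w : ℤ → ℝ) (P : Measure (ℕ → Bool)) : Prop :=
  ∀ (l : List Bool) (b : Bool),
    P (stackCyl (l ++ [b])) = P (stackCyl l) * ENNReal.ofReal (letterProb w l b)

def numUp (s : ℕ → Bool) (n : ℕ) : ℕ := (steps s n).count true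
def numDown (s : ℕ → Bool) (n : ℕ) : ℕ := (steps s n).count false

/-- The time of the `m`-th `false` letter. -/
def downTime (s : ℕ → Bool) (m : ℕ) : ℕ := sInf {n | m ≤ numDown s n}

/-- The number of `true` letters before the `m`-th `false` letter. -/
def upsBefore (s : ℕ → Bool) (m : ℕ) : ℕ := numUp s (downTime s m)

/-- The stack with all directions reversed. -/
def flipStack (s : ℕ → Bool) : ℕ → Bool := fun i => !s i

@[simp] lemma steps_zero (s : ℕ → Bool) : steps s 0 = [] := rfl

lemma steps_succ (s : ℕ → Bool) (n : ℕ) : steps s (n + 1) = steps s n ++ [s n] := by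
  simp [steps, List.range_succ]

@[simp] lemma length_steps (s : ℕ → Bool) (n : ℕ) : (steps s n).length = n := by simp [steps]

lemma steps_flipStack (s : ℕ → Bool) (n : ℕ) :
    steps (flipStack s) n = (steps s n).map (fun b => !b) := by
  simp [steps, flipStack, Function.comp_def]

lemma numUp_succ (s : ℕ → Bool) (n : ℕ) :
    numUp s (n + 1) = numUp s n + if s n = true then 1 else 0 := by
  unfold numUp; rw [steps_succ]; cases s n <;> simp

lemma numDown_succ (s : ℕ → Bool) (n : ℕ) :
    numDown s (n + 1) = numDown s n + if s n = false then 1 else 0 := by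
  unfold numDown; rw [steps_succ]; cases s n <;> simp

@[simp] lemma numUp_zero (s : ℕ → Bool) : numUp s 0 = 0 := rfl

@[simp] lemma numDown_zero (s : ℕ → Bool) : numDown s 0 = 0 := rfl

lemma numUp_add_numDown (s : ℕ → Bool) (n : ℕ) : numUp s n + numDown s n = n := by
  induction n with
  | zero => rfl
  | succ n ih => rw [numUp_succ, numDown_succ]; cases s n <;> simp <;> omega

lemma numDown_flipStack (s : ℕ → Bool) (n : ℕ) : numDown (flipStack s) n = numUp s n := by
  induction n with
  | zero => rfl
  | succ n ih => rw [numUp_succ, numDown_succ, ih]; simp [flipStack]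

lemma numUp_mono (s : ℕ → Bool) : Monotone (numUp s) :=
  monotone_nat_of_le_succ fun n => by rw [numUp_succ]; omega

lemma numDown_mono (s : ℕ → Bool) : Monotone (numDown s) :=
  monotone_nat_of_le_succ fun n => by rw [numDown_succ]; omega

lemma excess_steps (s : ℕ → Bool) (n : ℕ) : excess (steps s n) = (numUp s n : ℤ) - numDown s n :=
  rfl

lemma downTime_zero (s : ℕ → Bool) : downTime s 0 = 0 := by
  have : (0 : ℕ) ∈ {n | 0 ≤ numDown s n} := by simp
  exact Nat.le_zero.1 (Nat.sInf_le this)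

@[simp] lemma upsBefore_zero (s : ℕ → Bool) : upsBefore s 0 = 0 := by
  simp [upsBefore, downTime_zero]

/-- Stacks with infinitely many `false` letters. -/
def HasDowns (s : ℕ → Bool) : Prop := ∀ m, ∃ n, m ≤ numDown s n

lemma lt_downTime_iff {s : ℕ → Bool} (hs : HasDowns s) (m n : ℕ) :
    n < downTime s m ↔ numDown s n < m := by
  constructor
  · intro h
    by_contra! h2
    have h3 : downTime s m ≤ n := Nat.sInf_le h2
    omega
  · intro h
    by_contra! h2
    have h3 : m ≤ numDown s (downTime s m) := Nat.sInf_mem (hs m)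
    have := numDown_mono s h2
    omega

lemma numDown_downTime {s : ℕ → Bool} (hs : HasDowns s) (m : ℕ) :
    numDown s (downTime s m) = m := by
  have h3 : m ≤ numDown s (downTime s m) := Nat.sInf_mem (hs m)
  rcases Nat.eq_zero_or_pos (downTime s m) with h | h
  · rw [h] at h3 ⊢; simp at h3 ⊢; omega
  · obtain ⟨t, ht⟩ : ∃ t, downTime s m = t + 1 := ⟨downTime s m - 1, by omega⟩
    have := (lt_downTime_iff hs m t).1 (by omega)
    rw [ht, numDown_succ] at h3 ⊢
    split_ifs at * <;> omega

lemma downTime_eq {s : ℕ → Bool} (hs : HasDowns s) (m : ℕ) :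
    downTime s m = upsBefore s m + m := by
  have := numUp_add_numDown s (downTime s m)
  rw [numDown_downTime hs] at this
  exact this.symm

lemma numUp_upsBefore {s : ℕ → Bool} (hs : HasDowns s) (m : ℕ) :
    numUp s (upsBefore s m + m) = upsBefore s m := by
  rw [← downTime_eq hs]; rfl

/-- Before the `m`-th `false` letter there are fewer than `m` of them. -/
lemma numDown_lt_of_lt {s : ℕ → Bool} (hs : HasDowns s) (m n : ℕ) (h : n < upsBefore s m + m) :
    numDown s n < m := by
  rw [← downTime_eq hs] at h
  exact (lt_downTime_iff hs m n).1 h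

lemma measurable_steps (n : ℕ) : Measurable[_, ⊤] (fun s : ℕ → Bool => steps s n) := by
  induction n with
  | zero => exact measurable_const
  | succ n ih =>
    simp_rw [steps_succ]
    let _ : MeasurableSpace (List Bool) := ⊤
    have h2 : Measurable (fun s : ℕ → Bool => [s n]) :=
      (measurable_from_top (f := fun b : Bool => [b])).comp (measurable_pi_apply n)
    exact (measurable_from_prod_countable_left (f := fun p : List Bool × List Bool => p.1 ++ p.2)
      (fun _ => measurable_from_top)).comp (ih.prodMk h2)

lemma measurableSet_steps (n : ℕ) (Q : Set (List Bool)) :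
    MeasurableSet {s : ℕ → Bool | steps s n ∈ Q} :=
  measurable_steps n (t := Q) trivial

lemma measurable_numDown (n : ℕ) : Measurable (fun s : ℕ → Bool => numDown s n) := by
  let _ : MeasurableSpace (List Bool) := ⊤
  exact (measurable_from_top (f := fun l : List Bool => l.count false)).comp (measurable_steps n)

lemma measurable_numUp (n : ℕ) : Measurable (fun s : ℕ → Bool => numUp s n) := by
  let _ : MeasurableSpace (List Bool) := ⊤
  exact (measurable_from_top (f := fun l : List Bool => l.count true)).comp (measurable_steps n)

lemma measurable_sInf_nat {α : Type*} [MeasurableSpace α] {Q : ℕ → α → Prop}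
    (hQ : ∀ n, MeasurableSet {a | Q n a}) : Measurable fun a => sInf {n | Q n a} := by
  refine measurable_to_countable' fun k => ?_
  have : (fun a => sInf {n | Q n a}) ⁻¹' {k} =
      ({a | Q k a} ∩ ⋂ j, ⋂ (_ : j < k), {a | Q j a}ᶜ) ∪
        ({_a | k = 0} ∩ ⋂ j, {a | Q j a}ᶜ) := by
    ext a
    simp only [Set.mem_preimage, Set.mem_singleton_iff, Set.mem_union, Set.mem_inter_iff,
      Set.mem_iInter, Set.mem_compl_iff, Set.mem_ofPred_eq]
    constructor
    · rintro rfl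
      rcases Set.eq_empty_or_nonempty {n | Q n a} with h | h
      · right
        rw [h, Nat.sInf_empty]
        exact ⟨rfl, fun j hj => by
          have : j ∈ {n | Q n a} := hj
          simp [h] at this⟩
      · exact Or.inl ⟨Nat.sInf_mem h, fun j hj => Nat.notMem_of_lt_sInf hj⟩
    · rintro (⟨h1, h2⟩ | ⟨rfl, h2⟩)
      · refine le_antisymm (Nat.sInf_le h1) ?_
        by_contra! h3
        exact h2 _ h3 (Nat.sInf_mem (s := {n | Q n a}) ⟨k, h1⟩)
      · rw [Nat.sInf_eq_zero]
        exact Or.inr (Set.eq_empty_of_forall_notMem h2)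
  rw [this]
  exact ((hQ k).inter (MeasurableSet.iInter fun j => MeasurableSet.iInter fun _ =>
    (hQ j).compl)).union ((MeasurableSet.const _).inter
      (MeasurableSet.iInter fun j => (hQ j).compl))

lemma measurable_downTime (m : ℕ) : Measurable (fun s : ℕ → Bool => downTime s m) :=
  measurable_sInf_nat fun n => measurableSet_le measurable_const (measurable_numDown n)

lemma measurable_upsBefore (m : ℕ) : Measurable (fun s : ℕ → Bool => upsBefore s m) :=
  (measurable_from_prod_countable_left (f := fun p : (ℕ → Bool) × ℕ => numUp p.1 p.2)
      (fun n => measurable_numUp n)).comp (measurable_id.prodMk (measurable_downTime m))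

lemma measurable_flipStack : Measurable flipStack :=
  measurable_pi_lambda _ fun i =>
    (measurable_from_top (f := fun b : Bool => !b)).comp (measurable_pi_apply i)

lemma measurableSet_stackCyl (l : List Bool) : MeasurableSet (stackCyl l) :=
  measurableSet_steps l.length {l}

lemma IsStackLaw.map_flipStack {w : ℤ → ℝ} {P : Measure (ℕ → Bool)} (hP : IsStackLaw w P) :
    IsStackLaw w (P.map flipStack) := by
  have key : ∀ l : List Bool, flipStack ⁻¹' stackCyl l = stackCyl (l.map (fun b => !b)) := by
    intro l
    ext s
    simp only [stackCyl, Set.mem_preimage, Set.mem_ofPred_eq, steps_flipStack, List.length_map]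
    constructor
    · intro h; conv_rhs => rw [← h]
      simp [Function.comp_def]
    · intro h; rw [h]; simp [Function.comp_def]
  intro l b
  rw [Measure.map_apply measurable_flipStack (measurableSet_stackCyl _),
    Measure.map_apply measurable_flipStack (measurableSet_stackCyl _), key, key, List.map_append,
    List.map_singleton, hP]
  congr 2
  have h1 : ∀ l : List Bool, excess (l.map (fun b => !b)) = -excess l := by
    intro l
    induction l with
    | nil => rfl
    | cons a l ih => cases a <;> simp [excess] at ih ⊢ <;> omega
  unfold letterProb
  rw [h1]
  cases b <;> simp

/-- Markov property of a single stack. -/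
lemma IsStackLaw.measure_step {w : ℤ → ℝ} {P : Measure (ℕ → Bool)} (hP : IsStackLaw w P) (n : ℕ)
    (Q : Set (List Bool)) (b : Bool) (c : ℝ) (hQ : ∀ l ∈ Q, letterProb w l b = c) :
    P {s | steps s n ∈ Q ∧ s n = b} = P {s | steps s n ∈ Q} * ENNReal.ofReal c := by
  set Q' : Set (List Bool) := {l ∈ Q | l.length = n} with hQ'
  have hc : Q'.Countable := Set.to_countable _
  have e1 : {s : ℕ → Bool | steps s n ∈ Q} = ⋃ l ∈ Q', stackCyl l := by
    ext s
    simp only [Set.mem_ofPred_eq, Set.mem_iUnion, stackCyl, exists_prop, hQ']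
    constructor
    · intro h; exact ⟨steps s n, ⟨h, by simp⟩, by simp⟩
    · rintro ⟨l, ⟨h1, h2⟩, h3⟩; rw [h2] at h3; rwa [h3]
  have e2 : {s : ℕ → Bool | steps s n ∈ Q ∧ s n = b} = ⋃ l ∈ Q', stackCyl (l ++ [b]) := by
    ext s
    simp only [Set.mem_ofPred_eq, Set.mem_iUnion, stackCyl, exists_prop, hQ', List.length_append,
      List.length_singleton, steps_succ]
    constructor
    · rintro ⟨h, h'⟩; exact ⟨steps s n, ⟨h, by simp⟩, by simp [h']⟩
    · rintro ⟨l, ⟨h1, h2⟩, h3⟩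
      rw [h2] at h3
      have := List.append_inj h3 (by simp [h2])
      refine ⟨by rw [this.1]; exact h1, by simpa using this.2⟩
  rw [e1, e2, measure_biUnion hc _ (fun l _ => measurableSet_stackCyl _),
    measure_biUnion hc _ (fun l _ => measurableSet_stackCyl _), ← ENNReal.tsum_mul_right]
  · refine tsum_congr fun l => ?_
    rw [hP, hQ _ l.2.1]
  · intro l hl l' hl' hne
    refine Set.disjoint_left.2 fun s h1 h2 => hne ?_
    simp only [stackCyl, Set.mem_ofPred_eq, hl.2, hl'.2] at h1 h2
    exact h1.symm.trans h2
  · intro l hl l' hl' hne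
    refine Set.disjoint_left.2 fun s h1 h2 => hne ?_
    simp only [stackCyl, Set.mem_ofPred_eq, hl.2, hl'.2, List.length_append,
      List.length_singleton] at h1 h2
    have h3 := h1.symm.trans h2
    exact (List.append_inj h3 (by simp [hl.2, hl'.2])).1

lemma excess_steps_add (s : ℕ → Bool) (n : ℕ) :
    excess (steps s n) + 2 * numDown s n = n := by
  rw [excess_steps]
  have := numUp_add_numDown s n
  omega

lemma measure_excess_ge {w : ℤ → ℝ} (hw : ∀ z, 0 < w z) {P : Measure (ℕ → Bool)}
    [IsProbabilityMeasure P] (hP : IsStackLaw w P) (n : ℕ) (t : ℤ) (ht : Even (t - n)) :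
    P.real {s | t ≤ excess (steps s n)} = tailRec w n t := by
  induction n generalizing t with
  | zero =>
    have : ∀ s : ℕ → Bool, excess (steps s 0) = 0 := fun s => rfl
    simp only [this, tailRec]
    split_ifs with h
    · simp [h]
    · simp [h]
  | succ n ih =>
    obtain ⟨k, hk⟩ := ht
    push_cast at hk
    have m1 : ∀ t : ℤ, MeasurableSet {s : ℕ → Bool | t ≤ excess (steps s n)} := fun t =>
      measurableSet_steps n {l | t ≤ excess l}
    have e0 : {s : ℕ → Bool | t ≤ excess (steps s (n + 1))} =
        {s | t + 1 ≤ excess (steps s n)} ∪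
          {s | steps s n ∈ {l | excess l = t - 1} ∧ s n = true} := by
      ext s
      have h1 := excess_steps_add s n
      have h2 := excess_steps_add s (n + 1)
      rw [numDown_succ] at h2
      push_cast at h2
      simp only [Set.mem_union, Set.mem_ofPred_eq]
      cases hb : s n <;> simp [hb] at h2 ⊢ <;> omega
    have e1 : {s : ℕ → Bool | t - 1 ≤ excess (steps s n)} =
        {s | t + 1 ≤ excess (steps s n)} ∪ {s | steps s n ∈ {l | excess l = t - 1}} := by
      ext s
      have h1 := excess_steps_add s n
      simp only [Set.mem_union, Set.mem_ofPred_eq]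
      omega
    have f1 := measureReal_union (μ := P) (s₁ := {s | t + 1 ≤ excess (steps s n)})
      (s₂ := {s | steps s n ∈ {l | excess l = t - 1}})
      (Set.disjoint_left.2 fun s h1 h2 => by simp only [Set.mem_ofPred_eq] at h1 h2; omega)
      (measurableSet_steps n _)
    have m2 : MeasurableSet {s : ℕ → Bool | steps s n ∈ {l | excess l = t - 1} ∧ s n = true} :=
      MeasurableSet.inter (s₁ := {s | steps s n ∈ {l | excess l = t - 1}})
        (s₂ := (fun f : ℕ → Bool => f n) ⁻¹' {true})
        (measurableSet_steps n {l | excess l = t - 1})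
        (measurable_pi_apply n (measurableSet_singleton true))
    have f0 := measureReal_union (μ := P) (s₁ := {s | t + 1 ≤ excess (steps s n)})
      (s₂ := {s | steps s n ∈ {l | excess l = t - 1} ∧ s n = true})
      (Set.disjoint_left.2 fun s h1 h2 => by simp only [Set.mem_ofPred_eq] at h1 h2; omega) m2
    have f2 : P.real {s | steps s n ∈ {l | excess l = t - 1} ∧ s n = true} =
        P.real {s | steps s n ∈ {l | excess l = t - 1}} * upProb w (t - 1) := by
      rw [measureReal_def, hP.measure_step n _ true (upProb w (t - 1)), ENNReal.toReal_mul,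
        ENNReal.toReal_ofReal (upProb_pos hw _).le, measureReal_def]
      intro l hl
      simp only [Set.mem_ofPred_eq] at hl
      simp [letterProb, hl]
    rw [e0, f0, f2, ih (t + 1) ⟨k + 1, by omega⟩]
    rw [← e1, ih (t + 1) ⟨k + 1, by omega⟩, ih (t - 1) ⟨k, by omega⟩] at f1
    conv_rhs => unfold tailRec
    rw [upProb_one_sub hw]
    linear_combination (-upProb w (t - 1)) * f1

lemma measure_numDown_lt {w : ℤ → ℝ} (hw : ∀ z, 0 < w z) {P : Measure (ℕ → Bool)}
    [IsProbabilityMeasure P] (hP : IsStackLaw w P) (n m : ℕ) :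
    P.real {s | numDown s n < m} = tailRec w n (n - 2 * m + 2) := by
  rw [← measure_excess_ge hw hP n _ ⟨1 - m, by ring⟩]
  congr 1
  ext s
  have := excess_steps_add s n
  simp only [Set.mem_ofPred_eq]
  omega

lemma IsStackLaw.ae_hasDowns {w : ℤ → ℝ} (hw : GoodWeight w) {P : Measure (ℕ → Bool)}
    [IsProbabilityMeasure P] (hP : IsStackLaw w P) : ∀ᵐ s ∂P, HasDowns s := by
  unfold HasDowns
  rw [ae_all_iff]
  intro m
  obtain ⟨θ, h0, h1, C, hC, hb⟩ := exists_tailRec_le hw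
  rw [ae_iff]
  have key : ∀ n : ℕ, P.real {s | ¬ ∃ n, m ≤ numDown s n} ≤ C * θ ^ n := by
    intro n
    calc P.real {s | ¬ ∃ n, m ≤ numDown s n} ≤ P.real {s | numDown s (n + 2 * m) < m} := by
          refine measureReal_mono fun s hs => ?_
          simp only [Set.mem_ofPred_eq, not_exists, not_le] at hs ⊢
          exact hs _
      _ = tailRec w (n + 2 * m) ((n + 2 : ℕ) : ℤ) := by
          rw [measure_numDown_lt hw.1 hP]; congr 1; push_cast; ring
      _ ≤ C * θ ^ (n + 2) := hb _ _
      _ ≤ C * θ ^ n := by gcongr C * ?_; exact pow_le_pow_of_le_one h0.le h1.le (by omega)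
  have lim : Tendsto (fun n : ℕ => C * θ ^ n) atTop (𝓝 0) := by
    simpa using (tendsto_pow_atTop_nhds_zero_of_lt_one h0.le h1).const_mul C
  have := ge_of_tendsto' lim key
  have h2 : P.real {s | ¬ ∃ n, m ≤ numDown s n} = 0 := le_antisymm this measureReal_nonneg
  rwa [measureReal_eq_zero_iff] at h2

lemma measure_lt_downTime {w : ℤ → ℝ} (hw : GoodWeight w) {P : Measure (ℕ → Bool)}
    [IsProbabilityMeasure P] (hP : IsStackLaw w P) (n m : ℕ) :
    P.real {s | n < downTime s m} = tailRec w n (n - 2 * m + 2) := by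
  rw [← measure_numDown_lt hw.1 hP]
  refine measureReal_congr ?_
  filter_upwards [hP.ae_hasDowns hw] with s hs
  exact propext (lt_downTime_iff hs m n)

lemma measure_downTime_le {w : ℤ → ℝ} (hw : GoodWeight w) {P : Measure (ℕ → Bool)}
    [IsProbabilityMeasure P] (hP : IsStackLaw w P) (n m : ℕ) :
    P.real {s | downTime s m ≤ n} = tailRec w n (2 * m - n) := by
  have h1 := measure_lt_downTime hw hP n m
  have h2 := tailRec_symm hw.1 n (n - 2 * m + 2) ⟨1 - m, by ring⟩
  have h3 : {s | downTime s m ≤ n} = {s | n < downTime s m}ᶜ := by ext s; simp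
  rw [h3, measureReal_compl (measurableSet_lt measurable_const (measurable_downTime m)), h1,
    probReal_univ, ← h2]
  ring_nf

lemma natCast_eq_tsum (k : ℕ) : (k : ℝ≥0∞) = ∑' i : ℕ, if i < k then 1 else 0 := by
  rw [tsum_eq_sum (s := Finset.range k)]
  · rw [Finset.sum_congr rfl (g := fun _ => (1 : ℝ≥0∞))]
    · simp
    · intro i hi; rw [if_pos (Finset.mem_range.1 hi)]
  · intro i hi; rw [if_neg (by simpa using hi)]

lemma natCast_sq_eq_tsum (k : ℕ) :
    ((k ^ 2 : ℕ) : ℝ≥0∞) = ∑' i : ℕ, if i < k then ((2 * i + 1 : ℕ) : ℝ≥0∞) else 0 := by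
  rw [tsum_eq_sum (s := Finset.range k)]
  · rw [Finset.sum_congr rfl (g := fun i => ((2 * i + 1 : ℕ) : ℝ≥0∞))]
    · rw [← Nat.cast_sum]
      congr 1
      induction k with
      | zero => rfl
      | succ k ih => rw [Finset.sum_range_succ, ← ih]; ring
    · intro i hi; rw [if_pos (Finset.mem_range.1 hi)]
  · intro i hi; rw [if_neg (by simpa using hi)]

/-- The summands of the deviation of the mean of `upsBefore s m` from `m - 1 / 2`. -/
def meanTerm (w : ℤ → ℝ) (m i : ℕ) : ℝ :=
  tailRec w (2 * m + i) ((i + 2 : ℕ) : ℤ) -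
    if i + 2 ≤ 2 * m then tailRec w (2 * m - 2 - i) ((i + 2 : ℕ) : ℤ) else 0

lemma meanTerm_nonneg {w : ℤ → ℝ} (hw : ∀ z, 0 < w z) (m i : ℕ) : 0 ≤ meanTerm w m i := by
  unfold meanTerm
  split_ifs with h
  · have := tailRec_mono hw (2 * m - 2 - i) (i + 1) ((i + 2 : ℕ) : ℤ)
      ⟨i + 2 - m, by push_cast [Nat.sub_sub, Nat.cast_sub (by omega : 2 + i ≤ 2 * m)]; ring⟩
      (by push_cast; omega)
    rw [show 2 * m - 2 - i + 2 * (i + 1) = 2 * m + i by omega] at this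
    linarith
  · simpa using tailRec_nonneg hw _ _

lemma tendsto_tsum_meanTerm {w : ℤ → ℝ} (hw : GoodWeight w) :
    Tendsto (fun m => ∑' i, meanTerm w m i) atTop (𝓝 0) := by
  obtain ⟨θ, h0, h1, C, hC, hb⟩ := exists_tailRec_le hw
  have hle : ∀ m i, meanTerm w m i ≤ C * θ ^ i := fun m i => by
    have e1 := hb (2 * m + i) (i + 2)
    have e2 : θ ^ (i + 2) ≤ θ ^ i := pow_le_pow_of_le_one h0.le h1.le (by omega)
    have e3 : 0 ≤ if i + 2 ≤ 2 * m then tailRec w (2 * m - 2 - i) ((i + 2 : ℕ) : ℤ) else 0 := by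
      split_ifs
      · exact tailRec_nonneg hw.1 _ _
      · exact le_rfl
    have e4 : C * θ ^ (i + 2) ≤ C * θ ^ i := by gcongr
    unfold meanTerm
    linarith
  have := tendsto_tsum_of_dominated_convergence (𝓕 := atTop) (f := fun m i => meanTerm w m i)
    (g := fun _ => (0 : ℝ)) (bound := fun i => C * θ ^ i)
    ((summable_geometric_of_lt_one h0.le h1).mul_left C) ?_
    (Eventually.of_forall fun m i => by
      rw [Real.norm_of_nonneg (meanTerm_nonneg hw.1 m i)]; exact hle m i)
  · simpa using this
  · intro i
    have hmono : Monotone fun m : ℕ => tailRec w (2 * m + i) ((i + 2 : ℕ) : ℤ) :=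
      monotone_nat_of_le_succ fun m => by
        have := tailRec_mono_two hw.1 (2 * m + i) ((i + 2 : ℕ) : ℤ)
          ⟨1 - m, by push_cast; ring⟩ (by push_cast; omega)
        rwa [show 2 * (m + 1) + i = 2 * m + i + 2 by ring]
    have hconv := tendsto_atTop_ciSup hmono
      ⟨1, by rintro _ ⟨m, rfl⟩; exact tailRec_le_one hw.1 _ _⟩
    have hconv2 := hconv.comp (tendsto_sub_atTop_nat (i + 1))
    have := hconv.sub hconv2
    rw [sub_self] at this
    refine this.congr' ?_
    filter_upwards [eventually_ge_atTop (i + 1)] with m hm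
    simp only [meanTerm, Function.comp]
    rw [if_pos (by omega), show 2 * (m - (i + 1)) + i = 2 * m - 2 - i by omega]

lemma IsStackLaw.lintegral_downTime_sub {w : ℤ → ℝ} (hw : GoodWeight w) {P : Measure (ℕ → Bool)}
    [IsProbabilityMeasure P] (hP : IsStackLaw w P) (m : ℕ) :
    ∫⁻ s, ((downTime s m - 2 * m : ℕ) : ℝ≥0∞) ∂P =
      ENNReal.ofReal (∑' i : ℕ, tailRec w (2 * m + i) ((i + 2 : ℕ) : ℤ)) := by
  obtain ⟨θ, h0, h1, C, hC, hb⟩ := exists_tailRec_le hw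
  have hsum : Summable fun i : ℕ => tailRec w (2 * m + i) ((i + 2 : ℕ) : ℤ) := by
    refine Summable.of_nonneg_of_le (fun i => tailRec_nonneg hw.1 _ _) (fun i => hb _ _) ?_
    exact ((summable_nat_add_iff 2).2 (summable_geometric_of_lt_one h0.le h1)).mul_left C
  rw [ENNReal.ofReal_tsum_of_nonneg (fun i => tailRec_nonneg hw.1 _ _) hsum]
  simp_rw [natCast_eq_tsum]
  have hm : ∀ i, MeasurableSet {s | i < downTime s m - 2 * m} := fun i =>
    measurableSet_lt measurable_const ((measurable_downTime m).sub_const _)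
  rw [lintegral_tsum fun i => (Measurable.ite (hm i) measurable_const measurable_const).aemeasurable]
  refine tsum_congr fun i => ?_
  have : ∀ s, (if i < downTime s m - 2 * m then (1 : ℝ≥0∞) else 0) =
      Set.indicator {s | i < downTime s m - 2 * m} 1 s := fun s => by
    simp [Set.indicator_apply]
  simp_rw [this]
  rw [lintegral_indicator_one (hm i), ← ofReal_measureReal]
  congr 1
  have e : {s | i < downTime s m - 2 * m} = {s | 2 * m + i < downTime s m} := by
    ext s; simp only [Set.mem_ofPred_eq]; omega
  rw [e, measure_lt_downTime hw hP]
  congr 1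
  push_cast; ring

lemma integrable_natCast_of_lintegral {α : Type*} [MeasurableSpace α] {μ : Measure α} {f : α → ℕ}
    (hf : Measurable f) {c : ℝ} (hc : 0 ≤ c)
    (h : ∫⁻ x, (f x : ℝ≥0∞) ∂μ = ENNReal.ofReal c) :
    Integrable (fun x => (f x : ℝ)) μ ∧ ∫ x, (f x : ℝ) ∂μ = c := by
  have h1 : ∫⁻ x, ENNReal.ofReal (f x : ℝ) ∂μ = ENNReal.ofReal c := by
    simpa using h
  have hm : Measurable fun x => (f x : ℝ) := measurable_from_top.comp hf
  refine ⟨⟨hm.aestronglyMeasurable, ?_⟩, ?_⟩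
  · rw [hasFiniteIntegral_iff_ofReal (Eventually.of_forall fun x => Nat.cast_nonneg _), h1]
    exact ENNReal.ofReal_lt_top
  · rw [integral_eq_lintegral_of_nonneg_ae (Eventually.of_forall fun x => Nat.cast_nonneg _)
      hm.aestronglyMeasurable, h1, ENNReal.toReal_ofReal hc]

lemma IsStackLaw.lintegral_sub_downTime {w : ℤ → ℝ} (hw : GoodWeight w) {P : Measure (ℕ → Bool)}
    [IsProbabilityMeasure P] (hP : IsStackLaw w P) (m : ℕ) :
    ∫⁻ s, ((2 * m - downTime s m : ℕ) : ℝ≥0∞) ∂P =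
      ENNReal.ofReal (∑ i ∈ Finset.range (2 * m), tailRec w (2 * m - 1 - i) ((i + 1 : ℕ) : ℤ)) := by
  rw [ENNReal.ofReal_sum_of_nonneg (fun i _ => tailRec_nonneg hw.1 _ _)]
  have : ∀ s, ((2 * m - downTime s m : ℕ) : ℝ≥0∞) = ∑ i ∈ Finset.range (2 * m),
      Set.indicator {s | downTime s m ≤ 2 * m - 1 - i} (fun _ => (1 : ℝ≥0∞)) s := fun s => by
    rw [natCast_eq_tsum, tsum_eq_sum (s := Finset.range (2 * m))]
    · refine Finset.sum_congr rfl fun i hi => ?_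
      have := Finset.mem_range.1 hi
      simp only [Set.indicator_apply, Set.mem_ofPred_eq]
      congr 1
      exact propext (by omega)
    · intro i hi
      rw [Finset.mem_range] at hi
      rw [if_neg (by omega)]
  have hm : ∀ i, MeasurableSet {s | downTime s m ≤ 2 * m - 1 - i} := fun i =>
    measurableSet_le (measurable_downTime m) measurable_const
  simp_rw [this]
  rw [lintegral_finsetSum _ fun i _ => measurable_const.indicator (hm i)]
  refine Finset.sum_congr rfl fun i hi => ?_
  have := Finset.mem_range.1 hi
  rw [lintegral_indicator_const (hm i), one_mul, ← ofReal_measureReal, measure_downTime_le hw hP]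
  congr 2
  push_cast [Nat.sub_sub, Nat.cast_sub (by omega : 1 + i ≤ 2 * m)]; ring

lemma IsStackLaw.integral_upsBefore {w : ℤ → ℝ} (hw : GoodWeight w) {P : Measure (ℕ → Bool)}
    [IsProbabilityMeasure P] (hP : IsStackLaw w P) (m : ℕ) (hm : 1 ≤ m) :
    Integrable (fun s => (upsBefore s m : ℝ) - m) P ∧
      ∫ s, ((upsBefore s m : ℝ) - m) ∂P = -(1 / 2) + ∑' i, meanTerm w m i := by
  obtain ⟨i1, e1⟩ := integrable_natCast_of_lintegral
    ((measurable_downTime m).sub_const (2 * m))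
    (tsum_nonneg fun i => tailRec_nonneg hw.1 _ _) (hP.lintegral_downTime_sub hw m)
  obtain ⟨i2, e2⟩ := integrable_natCast_of_lintegral
    ((measurable_downTime m).const_sub (2 * m))
    (Finset.sum_nonneg fun i _ => tailRec_nonneg hw.1 _ _) (hP.lintegral_sub_downTime hw m)
  have hae : (fun s => (upsBefore s m : ℝ) - m) =ᵐ[P] fun s =>
      ((downTime s m - 2 * m : ℕ) : ℝ) - ((2 * m - downTime s m : ℕ) : ℝ) := by
    filter_upwards [hP.ae_hasDowns hw] with s hs
    have h := downTime_eq hs m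
    rcases le_total (2 * m) (downTime s m) with h2 | h2
    · rw [Nat.cast_sub h2, Nat.sub_eq_zero_of_le h2, h]; push_cast; ring
    · rw [Nat.cast_sub h2, Nat.sub_eq_zero_of_le h2, h]; push_cast; ring
  refine ⟨(i1.sub i2).congr hae.symm, ?_⟩
  rw [integral_congr_ae hae, integral_sub i1 i2, e1, e2]
  obtain ⟨θ, h0, h1, C, hC, hb⟩ := exists_tailRec_le hw
  have hsum : Summable fun i : ℕ => tailRec w (2 * m + i) ((i + 2 : ℕ) : ℤ) := by
    refine Summable.of_nonneg_of_le (fun i => tailRec_nonneg hw.1 _ _) (fun i => hb _ _) ?_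
    exact ((summable_nat_add_iff 2).2 (summable_geometric_of_lt_one h0.le h1)).mul_left C
  have hfin : ∀ i ∉ Finset.range (2 * m - 1),
      (if i + 2 ≤ 2 * m then tailRec w (2 * m - 2 - i) ((i + 2 : ℕ) : ℤ) else 0) = 0 := by
    intro i hi
    rw [Finset.mem_range] at hi
    rw [if_neg (by omega)]
  unfold meanTerm
  rw [hsum.tsum_sub (summable_of_ne_finset_zero hfin), tsum_eq_sum hfin]
  obtain ⟨k, hk⟩ : ∃ k, 2 * m = k + 1 := ⟨2 * m - 1, by omega⟩
  have h3 : ∑ i ∈ Finset.range (2 * m), tailRec w (2 * m - 1 - i) ((i + 1 : ℕ) : ℤ) =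
      1 / 2 + ∑ i ∈ Finset.range (2 * m - 1), (if i + 2 ≤ 2 * m then
        tailRec w (2 * m - 2 - i) ((i + 2 : ℕ) : ℤ) else 0) := by
    rw [hk, Finset.sum_range_succ', add_comm]
    congr 1
    · have := tailRec_one hw.1 (2 * m - 1) ⟨m - 1, by omega⟩
      rw [hk] at this
      simpa using this
    · refine Finset.sum_congr (by simp) fun i hi => ?_
      rw [Finset.mem_range] at hi
      rw [if_pos (by omega)]
      congr 1; omega
  rw [h3]
  ring

lemma exists_sq_moment {w : ℤ → ℝ} (hw : GoodWeight w) :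
    ∃ C : ℝ, 0 ≤ C ∧ ∀ (P : Measure (ℕ → Bool)) [IsProbabilityMeasure P], IsStackLaw w P → ∀ m,
      ∫⁻ s, ENNReal.ofReal (((upsBefore s m : ℝ) - m) ^ 2) ∂P ≤ ENNReal.ofReal C := by
  obtain ⟨θ, h0, h1, C, hC, hb⟩ := exists_tailRec_le hw
  have hsum : Summable fun i : ℕ => (2 * (i : ℝ) + 1) * (2 * C * θ ^ i) := by
    have s1 := summable_pow_mul_geometric_of_norm_lt_one 1
      (show ‖θ‖ < 1 by rwa [Real.norm_of_nonneg h0.le])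
    have s2 := summable_geometric_of_lt_one h0.le h1
    refine ((s1.mul_left (4 * C)).add (s2.mul_left (2 * C))).congr fun i => ?_
    ring
  have hnn : ∀ i : ℕ, 0 ≤ (2 * (i : ℝ) + 1) * (2 * C * θ ^ i) := fun i => by positivity
  refine ⟨∑' i : ℕ, (2 * (i : ℝ) + 1) * (2 * C * θ ^ i), tsum_nonneg hnn, ?_⟩
  intro P _ hP m
  rw [ENNReal.ofReal_tsum_of_nonneg hnn hsum]
  have hae : ∀ᵐ s ∂P, ENNReal.ofReal (((upsBefore s m : ℝ) - m) ^ 2) =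
      (((downTime s m - 2 * m + (2 * m - downTime s m)) ^ 2 : ℕ) : ℝ≥0∞) := by
    filter_upwards [hP.ae_hasDowns hw] with s hs
    have h := downTime_eq hs m
    rw [← ENNReal.ofReal_natCast]
    congr 1
    push_cast
    rcases le_total (2 * m) (downTime s m) with h2 | h2
    · rw [Nat.cast_sub h2, Nat.sub_eq_zero_of_le h2, h]; push_cast; ring
    · rw [Nat.cast_sub h2, Nat.sub_eq_zero_of_le h2, h]; push_cast; ring
  rw [lintegral_congr_ae hae]
  simp_rw [natCast_sq_eq_tsum]
  have hm : ∀ i, MeasurableSet {s | i < downTime s m - 2 * m + (2 * m - downTime s m)} := fun i =>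
    measurableSet_lt measurable_const
      (((measurable_downTime m).sub_const _).add ((measurable_downTime m).const_sub _))
  rw [lintegral_tsum fun i => (Measurable.ite (hm i) measurable_const measurable_const).aemeasurable]
  refine ENNReal.tsum_le_tsum fun i => ?_
  have : ∀ s, (if i < downTime s m - 2 * m + (2 * m - downTime s m) then
      ((2 * i + 1 : ℕ) : ℝ≥0∞) else 0) = Set.indicator
        {s | i < downTime s m - 2 * m + (2 * m - downTime s m)}
          (fun _ => ((2 * i + 1 : ℕ) : ℝ≥0∞)) s := fun s => by
    simp [Set.indicator_apply]
  simp_rw [this]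
  rw [lintegral_indicator_const (hm i), ENNReal.ofReal_mul (by positivity),
    ← ENNReal.ofReal_natCast]
  push_cast
  gcongr
  rw [← ofReal_measureReal]
  apply ENNReal.ofReal_le_ofReal
  have hpow1 : θ ^ (i + 1) ≤ θ ^ i := pow_le_pow_of_le_one h0.le h1.le (by omega)
  have hpow2 : θ ^ (i + 2) ≤ θ ^ i := pow_le_pow_of_le_one h0.le h1.le (by omega)
  have b1 : P.real {s | 2 * m + i < downTime s m} ≤ C * θ ^ i := by
    rw [measure_lt_downTime hw hP]
    have := hb (2 * m + i) (i + 2)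
    rw [show ((2 * m + i : ℕ) : ℤ) - 2 * m + 2 = ((i + 2 : ℕ) : ℤ) by push_cast; ring]
    exact this.trans (by gcongr)
  have b2 : P.real {s | downTime s m + i < 2 * m} ≤ C * θ ^ i := by
    rcases lt_or_ge i (2 * m) with hi | hi
    · have e : {s | downTime s m + i < 2 * m} = {s | downTime s m ≤ 2 * m - 1 - i} := by
        ext s; simp only [Set.mem_ofPred_eq]; omega
      rw [e, measure_downTime_le hw hP]
      have := hb (2 * m - 1 - i) (i + 1)
      rw [show (2 * m : ℤ) - ((2 * m - 1 - i : ℕ) : ℤ) = ((i + 1 : ℕ) : ℤ) by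
        omega]
      exact this.trans (by gcongr)
    · have e : {s | downTime s m + i < 2 * m} = ∅ := by
        refine Set.eq_empty_of_forall_notMem fun s hs => ?_
        simp only [Set.mem_ofPred_eq] at hs
        omega
      rw [e, measureReal_empty]
      positivity
  calc _ ≤ P.real ({s | 2 * m + i < downTime s m} ∪ {s | downTime s m + i < 2 * m}) := by
        refine measureReal_mono fun s hs => ?_
        simp only [Set.mem_union, Set.mem_ofPred_eq] at hs ⊢
        omega
    _ ≤ _ := measureReal_union_le _ _
    _ ≤ 2 * C * θ ^ i := by linarith

lemma exists_le_measure_upsBefore_eq_zero {w : ℤ → ℝ} (hw : GoodWeight w) (m : ℕ) :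
    ∃ p : ℝ, 0 < p ∧ ∀ (P : Measure (ℕ → Bool)) [IsProbabilityMeasure P], IsStackLaw w P →
      p ≤ P.real {s | upsBefore s m = 0} := by
  have h1 : ∀ m, ∃ p : ℝ, 0 < p ∧ ∀ (P : Measure (ℕ → Bool)) [IsProbabilityMeasure P],
      IsStackLaw w P → p ≤ P.real (stackCyl (List.replicate m false)) := by
    intro m
    induction m with
    | zero =>
      have : stackCyl (List.replicate 0 false) = Set.univ := by ext s; simp [stackCyl]
      exact ⟨1, one_pos, fun P _ _ => by rw [this, probReal_univ]⟩
    | succ m ih =>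
      obtain ⟨p, hp, h⟩ := ih
      have hq : 0 < letterProb w (List.replicate m false) false := by
        simpa [letterProb] using upProb_pos hw.1 _
      refine ⟨p * letterProb w (List.replicate m false) false, mul_pos hp hq, fun P _ hP => ?_⟩
      rw [List.replicate_succ', measureReal_def, hP, ENNReal.toReal_mul,
        ENNReal.toReal_ofReal hq.le]
      exact mul_le_mul_of_nonneg_right (h P hP) hq.le
  obtain ⟨p, hp, h⟩ := h1 m
  refine ⟨p, hp, fun P _ hP => (h P hP).trans (measureReal_mono fun s hs => ?_)⟩
  simp only [stackCyl, List.length_replicate, Set.mem_ofPred_eq] at hs ⊢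
  have h2 : numDown s m = m := by unfold numDown; rw [hs]; simp
  have h3 := numUp_add_numDown s m
  have h4 : downTime s m ≤ m := Nat.sInf_le (show m ≤ numDown s m by omega)
  have := numUp_mono s h4
  unfold upsBefore
  omega

lemma exists_tsum_meanTerm_le {w : ℤ → ℝ} (hw : GoodWeight w) :
    ∃ E : ℝ, 0 ≤ E ∧ ∀ m, ∑' i, meanTerm w m i ≤ E := by
  obtain ⟨E, hE⟩ := (tendsto_tsum_meanTerm hw).bddAbove_range
  exact ⟨E, (tsum_nonneg fun i => meanTerm_nonneg hw.1 0 i).trans (hE ⟨0, rfl⟩),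
    fun m => hE ⟨m, rfl⟩⟩

lemma exists_mul_tsum_meanTerm_le {w : ℤ → ℝ} (hw : GoodWeight w) {δ : ℝ} (hδ : 0 < δ) :
    ∃ E : ℝ, 0 ≤ E ∧ ∀ m : ℕ, m * ∑' i, meanTerm w m i ≤ δ * m + E := by
  obtain ⟨E, hE0, hE⟩ := exists_tsum_meanTerm_le hw
  obtain ⟨m₀, h₀⟩ := eventually_atTop.1 ((tendsto_tsum_meanTerm hw).eventually (gt_mem_nhds hδ))
  refine ⟨m₀ * E, by positivity, fun m => ?_⟩
  rcases le_total m₀ m with h | h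
  · have := h₀ m h
    have h2 : 0 ≤ m₀ * E := by positivity
    have h3 : (m : ℝ) * ∑' i, meanTerm w m i ≤ m * δ := by gcongr
    linarith
  · have h1 : (m : ℝ) * ∑' i, meanTerm w m i ≤ m₀ * E := by
      have : (m : ℝ) ≤ m₀ := by exact_mod_cast h
      exact mul_le_mul this (hE m) (tsum_nonneg fun i => meanTerm_nonneg hw.1 m i) (by positivity)
    have h2 : 0 ≤ δ * m := by positivity
    linarith

lemma measurable_upsBefore_real (m : ℕ) :
    Measurable fun s : ℕ → Bool => (upsBefore s m : ℝ) :=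
  measurable_from_top.comp (measurable_upsBefore m)

lemma IsStackLaw.integrable_sq {w : ℤ → ℝ} (hw : GoodWeight w) {P : Measure (ℕ → Bool)}
    [IsProbabilityMeasure P] (hP : IsStackLaw w P) (m : ℕ) :
    Integrable (fun s => ((upsBefore s m : ℝ) - m) ^ 2) P := by
  obtain ⟨C, -, h⟩ := exists_sq_moment hw
  refine ⟨(((measurable_upsBefore_real m).sub_const _).pow_const 2).aestronglyMeasurable, ?_⟩
  rw [hasFiniteIntegral_iff_ofReal (Eventually.of_forall fun s => sq_nonneg _)]
  exact (h P hP m).trans_lt ENNReal.ofReal_lt_top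

lemma integral_sq_sub_le {C : ℝ} (hC : 0 ≤ C) {P : Measure (ℕ → Bool)} (m : ℕ)
    (h : ∫⁻ s, ENNReal.ofReal (((upsBefore s m : ℝ) - m) ^ 2) ∂P ≤ ENNReal.ofReal C) :
    ∫ s, ((upsBefore s m : ℝ) - m) ^ 2 ∂P ≤ C := by
  rw [integral_eq_lintegral_of_nonneg_ae (Eventually.of_forall fun s => sq_nonneg _)
    (((measurable_upsBefore_real m).sub_const _).pow_const 2).aestronglyMeasurable]
  exact ENNReal.toReal_le_of_le_ofReal hC h

/-- One step of the mean square comparison of the profile chain with its deterministic limit. -/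
lemma exists_sq_step {w : ℤ → ℝ} (hw : GoodWeight w) {δ : ℝ} (hδ : 0 < δ) :
    ∃ C : ℝ, 0 ≤ C ∧ ∀ (P : Measure (ℕ → Bool)) [IsProbabilityMeasure P], IsStackLaw w P →
      ∀ (m : ℕ) (a b : ℝ), 0 ≤ a → (b = a - 1 / 2 ∨ a = 0 ∧ b = 0) →
      ∫⁻ s, ENNReal.ofReal (((upsBefore s m : ℝ) - b) ^ 2) ∂P ≤
        ENNReal.ofReal ((m - a) ^ 2 + δ * m + C) := by
  obtain ⟨V, hV, hsq⟩ := exists_sq_moment hw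
  obtain ⟨E, hE0, hE⟩ := exists_tsum_meanTerm_le hw
  obtain ⟨E', hE0', hE'⟩ := exists_mul_tsum_meanTerm_le hw (half_pos hδ)
  refine ⟨V + E + 2 * E' + 1, by positivity, fun P _ hP m a b ha hb => ?_⟩
  rcases Nat.eq_zero_or_pos m with rfl | hm
  · simp only [upsBefore_zero, lintegral_const, measure_univ, mul_one]
    apply ENNReal.ofReal_le_ofReal
    push_cast
    rcases hb with rfl | ⟨rfl, rfl⟩ <;> nlinarith
  obtain ⟨i1, e1⟩ := hP.integral_upsBefore hw m hm
  have i2 := hP.integrable_sq hw m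
  have e2 := integral_sq_sub_le hV m (hsq P hP m)
  set e := ∑' i, meanTerm w m i with he
  have he0 : 0 ≤ e := tsum_nonneg fun i => meanTerm_nonneg hw.1 m i
  have hexp : ∀ s, ((upsBefore s m : ℝ) - b) ^ 2 = ((upsBefore s m : ℝ) - m) ^ 2 +
      2 * (m - b) * ((upsBefore s m : ℝ) - m) + (m - b) ^ 2 := fun s => by ring
  have i4 : Integrable (fun s => ((upsBefore s m : ℝ) - m) ^ 2 +
      2 * (m - b) * ((upsBefore s m : ℝ) - m)) P := i2.add (i1.const_mul _)
  have i3 : Integrable (fun s => ((upsBefore s m : ℝ) - b) ^ 2) P := by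
    simp_rw [hexp]
    exact i4.add (integrable_const _)
  rw [← ofReal_integral_eq_lintegral_ofReal i3 (Eventually.of_forall fun s => sq_nonneg _)]
  apply ENNReal.ofReal_le_ofReal
  simp_rw [hexp]
  rw [integral_add i4 (integrable_const _),
    integral_add i2 (i1.const_mul _), integral_const_mul, e1, integral_const, probReal_univ,
    one_smul]
  have h1 := hE m
  have h2 := hE' m
  rw [← he] at h1 h2
  have h3 : 0 ≤ a * e := mul_nonneg ha he0
  rcases hb with rfl | ⟨rfl, rfl⟩
  · nlinarith
  · have : (1 : ℝ) ≤ m := by exact_mod_cast hm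
    nlinarith

lemma IsStackLaw.integrable_upsBefore {w : ℤ → ℝ} (hw : GoodWeight w) {P : Measure (ℕ → Bool)}
    [IsProbabilityMeasure P] (hP : IsStackLaw w P) (m : ℕ) (hm : 1 ≤ m) :
    Integrable (fun s => (upsBefore s m : ℝ)) P ∧
      ∫ s, (upsBefore s m : ℝ) ∂P = m - 1 / 2 + ∑' i, meanTerm w m i := by
  obtain ⟨i1, e1⟩ := hP.integral_upsBefore hw m hm
  have i2 : Integrable (fun s => (upsBefore s m : ℝ)) P := by
    exact (i1.add (integrable_const (m : ℝ))).congr (Eventually.of_forall fun s => by simp)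
  refine ⟨i2, ?_⟩
  rw [integral_sub i2 (integrable_const _), integral_const, probReal_univ, one_smul] at e1
  linarith

lemma exists_mean_step {w : ℤ → ℝ} (hw : GoodWeight w) :
    ∃ C : ℝ, 0 ≤ C ∧ ∀ (P : Measure (ℕ → Bool)) [IsProbabilityMeasure P], IsStackLaw w P →
      ∀ m : ℕ, ∫⁻ s, ENNReal.ofReal (upsBefore s m) ∂P ≤ ENNReal.ofReal (m + C) := by
  obtain ⟨E, hE0, hE⟩ := exists_tsum_meanTerm_le hw
  refine ⟨E, hE0, fun P _ hP m => ?_⟩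
  rcases Nat.eq_zero_or_pos m with rfl | hm
  · simp
  obtain ⟨i1, e1⟩ := hP.integrable_upsBefore hw m hm
  rw [← ofReal_integral_eq_lintegral_ofReal i1 (Eventually.of_forall fun s => Nat.cast_nonneg _),
    e1]
  apply ENNReal.ofReal_le_ofReal
  linarith [hE m]

/-- Lyapunov function for the absorption of the profile chain at `0`. -/
def lyap (κ : ℝ) (m : ℕ) : ℝ := m + if m = 0 then 0 else κ

lemma exists_lyap_step {w : ℤ → ℝ} (hw : GoodWeight w) :
    ∃ κ : ℝ, 0 ≤ κ ∧ ∀ (P : Measure (ℕ → Bool)) [IsProbabilityMeasure P], IsStackLaw w P →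
      ∀ m : ℕ, ∫⁻ s, ENNReal.ofReal (lyap κ (upsBefore s m)) ∂P +
        (if m = 0 then 0 else ENNReal.ofReal (1 / 4)) ≤ ENNReal.ofReal (lyap κ m) := by
  obtain ⟨E, hE0, hE⟩ := exists_tsum_meanTerm_le hw
  obtain ⟨m₀, h₀⟩ := eventually_atTop.1 ((tendsto_tsum_meanTerm hw).eventually
    (gt_mem_nhds (by norm_num : (0 : ℝ) < 1 / 4)))
  choose p hp hpP using exists_le_measure_upsBefore_eq_zero hw
  obtain ⟨q, hq0, hq⟩ : ∃ q : ℝ, 0 < q ∧ ∀ m < m₀, q ≤ p m := by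
    refine ⟨(insert 1 ((Finset.range m₀).image p)).min' (Finset.insert_nonempty _ _), ?_,
      fun m hm => Finset.min'_le _ _ (Finset.mem_insert_of_mem (Finset.mem_image_of_mem _
        (Finset.mem_range.2 hm)))⟩
    rw [Finset.lt_min'_iff]
    intro y hy
    rcases Finset.mem_insert.1 hy with rfl | hy
    · exact one_pos
    · obtain ⟨m, -, rfl⟩ := Finset.mem_image.1 hy
      exact hp m
  refine ⟨(E + 1 / 4) / q, by positivity, fun P _ hP m => ?_⟩
  rcases Nat.eq_zero_or_pos m with rfl | hm
  · simp [lyap]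
  set κ := (E + 1 / 4) / q with hκ
  have hκ0 : 0 ≤ κ := by positivity
  have hκq : κ * q = E + 1 / 4 := by rw [hκ]; field_simp
  obtain ⟨i1, e1⟩ := hP.integrable_upsBefore hw m hm
  have mz : MeasurableSet {s | upsBefore s m = 0} :=
    measurable_upsBefore m (measurableSet_singleton 0)
  have hl : ∀ s, lyap κ (upsBefore s m) =
      upsBefore s m + (κ - {s | upsBefore s m = 0}.indicator (fun _ => κ) s) := fun s => by
    by_cases h : upsBefore s m = 0 <;> simp [lyap, h]
  have i2 : Integrable ({s | upsBefore s m = 0}.indicator fun _ => κ) P :=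
    (integrable_const κ).indicator mz
  have i3 : Integrable (fun s => κ - {s | upsBefore s m = 0}.indicator (fun _ => κ) s) P :=
    (integrable_const κ).sub i2
  have hn : ∀ k, 0 ≤ lyap κ k := fun k => by
    unfold lyap; split_ifs <;> positivity
  have i4 : Integrable (fun s => lyap κ (upsBefore s m)) P := by
    simp_rw [hl]; exact i1.add i3
  rw [← ofReal_integral_eq_lintegral_ofReal i4 (Eventually.of_forall fun s => hn _),
    if_neg hm.ne', ← ENNReal.ofReal_add (integral_nonneg fun s => hn _) (by norm_num)]
  apply ENNReal.ofReal_le_ofReal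
  simp_rw [hl]
  rw [integral_add i1 i3, integral_sub (integrable_const κ) i2, integral_indicator_const _ mz,
    e1, integral_const, probReal_univ, lyap, if_neg hm.ne']
  simp only [smul_eq_mul, one_mul]
  rcases lt_or_ge m m₀ with h | h
  · have h1 : q ≤ P.real {s | upsBefore s m = 0} := (hq m h).trans (hpP m P hP)
    have h2 := mul_le_mul_of_nonneg_left h1 hκ0
    linarith [hE m]
  · have h1 : 0 ≤ P.real {s | upsBefore s m = 0} * κ := by positivity
    linarith [h₀ m h]

/-- The Markov chain of local times along successive sites: from the `i`-th site one reads off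
the number of `true` letters before the `L`-th `false` letter, and the chain receives an extra
unit of immigration at the first `N` sites. -/
def profile (σ : ℕ → ℕ → Bool) (R N : ℕ) : ℕ → ℕ
  | 0 => R
  | i + 1 => upsBefore (σ i) (profile σ R N i) + if i < N then 1 else 0

/-- The deterministic approximation of `profile`. -/
def profileMean (R N i : ℕ) : ℝ := if i ≤ N then (R : ℝ) + (i : ℝ) / 2 else max 0 ((R : ℝ) + N - (i : ℝ) / 2)

lemma profileMean_nonneg (R N i : ℕ) : 0 ≤ profileMean R N i := by
  unfold profileMean; split_ifs
  · positivity
  · exact le_max_left _ _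

lemma profileMean_of_le {R N i : ℕ} (h : N ≤ i) : profileMean R N i = max 0 ((R : ℝ) + N - (i : ℝ) / 2) := by
  unfold profileMean
  split_ifs with h2
  · obtain rfl := le_antisymm h h2
    rw [max_eq_right] <;> linarith [Nat.cast_nonneg (α := ℝ) R, Nat.cast_nonneg (α := ℝ) N]
  · rfl

lemma profileMean_succ (R N i : ℕ) :
    profileMean R N (i + 1) - (if i < N then 1 else 0) = profileMean R N i - 1 / 2 ∨
      profileMean R N i = 0 ∧ profileMean R N (i + 1) - (if i < N then 1 else 0) = 0 := by
  rcases lt_or_ge i N with h | h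
  · left
    rw [profileMean, profileMean, if_pos (by omega), if_pos h, if_pos h.le]
    push_cast; ring
  · rw [profileMean_of_le h, profileMean_of_le (by omega : N ≤ i + 1), if_neg (by omega)]
    rcases lt_or_ge i (2 * R + 2 * N) with h2 | h2
    · left
      have h3 : (i : ℝ) + 1 ≤ 2 * R + 2 * N := by exact_mod_cast h2
      rw [max_eq_right (by push_cast; linarith), max_eq_right (by linarith)]
      push_cast; ring
    · right
      have h3 : 2 * (R : ℝ) + 2 * N ≤ i := by exact_mod_cast h2
      rw [max_eq_left (by linarith), max_eq_left (by push_cast; linarith)]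
      simp

lemma profileMean_eq_zero {R N i : ℕ} (h : 2 * R + 2 * N ≤ i) : profileMean R N i = 0 := by
  have h3 : 2 * (R : ℝ) + 2 * N ≤ i := by exact_mod_cast h
  rw [profileMean_of_le (by omega), max_eq_left (by linarith)]

lemma abs_sum_profileMean_sub_le (R N K : ℕ) (hK : 2 * R + 2 * N ≤ K) :
    |∑ i ∈ Finset.range K, profileMean R N i - (R ^ 2 + 2 * R * N + N ^ 2 / 2 : ℝ)| ≤ (K : ℝ) / 4 := by
  have h1 : ∀ k ≤ N, ∑ i ∈ Finset.range k, profileMean R N i =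
      profileMean R N k ^ 2 - (R : ℝ) ^ 2 - (k : ℝ) / 4 := by
    intro k hk
    induction k with
    | zero => simp [profileMean]
    | succ k ih =>
      rw [Finset.sum_range_succ, ih (by omega)]
      have := profileMean_succ R N k
      rw [profileMean, profileMean, if_pos (by omega), if_pos hk]
      push_cast; ring
  have h2 : ∀ k, N ≤ k → |∑ i ∈ Finset.range k, profileMean R N i -
      (2 * profileMean R N N ^ 2 - (R : ℝ) ^ 2 - profileMean R N k ^ 2)| ≤ (k : ℝ) / 4 := by
    intro k hk
    induction k, hk using Nat.le_induction with
    | base => rw [h1 N le_rfl, abs_le]; constructor <;> nlinarith [Nat.cast_nonneg (α := ℝ) N]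
    | succ k hk ih =>
      rw [Finset.sum_range_succ]
      have h3 := profileMean_succ R N k
      rw [if_neg (by omega), sub_zero] at h3
      rw [abs_le] at ih ⊢
      push_cast
      rcases h3 with h3 | ⟨h3, h4⟩
      · rw [h3]; constructor <;> nlinarith
      · rw [h4]; rw [h3] at ih ⊢; constructor <;> nlinarith
  have := h2 K (by omega)
  rw [profileMean_eq_zero hK, profileMean, if_pos le_rfl] at this
  refine le_of_eq_of_le ?_ this
  congr 1; ring

lemma profile_congr {σ τ : ℕ → ℕ → Bool} {R N i : ℕ} (h : ∀ j < i, σ j = τ j) :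
    profile σ R N i = profile τ R N i := by
  induction i with
  | zero => rfl
  | succ i ih =>
    rw [profile, profile, ih fun j hj => h j (by omega), h i (by omega)]

lemma measurable_upsBefore_uncurry :
    Measurable fun p : (ℕ → Bool) × ℕ => upsBefore p.1 p.2 :=
  measurable_from_prod_countable_left fun m => measurable_upsBefore m

lemma measurable_profile (R N i : ℕ) : Measurable fun σ : ℕ → ℕ → Bool => profile σ R N i := by
  induction i with
  | zero => exact measurable_const
  | succ i ih =>
    exact (measurable_upsBefore_uncurry.comp ((measurable_pi_apply i).prodMk ih)).add_const _

section Chain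

variable {Ω : Type*} [MeasurableSpace Ω] {μ : Measure Ω} {S : ℕ → Ω → ℕ → Bool}

lemma measurable_profile_comp (hS : ∀ i, Measurable (S i)) (R N i : ℕ) :
    Measurable fun ω => profile (fun j => S j ω) R N i :=
  (measurable_profile R N i).comp (measurable_pi_lambda _ hS)

lemma indepFun_profile (hS : ∀ i, Measurable (S i)) (hind : ProbabilityTheory.iIndepFun S μ)
    (R N i : ℕ) :
    ProbabilityTheory.IndepFun (S i) (fun ω => profile (fun j => S j ω) R N i) μ := by
  have h := hind.indepFun_finset {i} (Finset.range i) (by simp) hS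
  let ψ : ((j : Finset.range i) → ℕ → Bool) → ℕ := fun v =>
    profile (fun j => if h : j ∈ Finset.range i then v ⟨j, h⟩ else fun _ => false) R N i
  have hψ : Measurable ψ := by
    refine (measurable_profile R N i).comp (measurable_pi_lambda _ fun j => ?_)
    by_cases hj : j ∈ Finset.range i
    · simp only [hj, dif_pos]; exact measurable_pi_apply _
    · simp only [hj, dif_neg, not_false_eq_true]; exact measurable_const
  have hφ : Measurable fun v : (({i} : Finset ℕ) → ℕ → Bool) => v ⟨i, by simp⟩ :=
    measurable_pi_apply _
  have h2 := h.comp hφ hψ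
  have e : (fun ω => profile (fun j => S j ω) R N i) =
      ψ ∘ fun ω (j : Finset.range i) => S j ω := by
    funext ω
    refine profile_congr fun j hj => ?_
    simp [hj]
  rw [e]
  exact h2

variable [IsProbabilityMeasure μ]

lemma lintegral_profile_step (hS : ∀ i, Measurable (S i))
    (hind : ProbabilityTheory.iIndepFun S μ) (R N i : ℕ) (f : (ℕ → Bool) → ℕ → ℝ≥0∞)
    (hf : ∀ m, Measurable fun s => f s m) (g : ℕ → ℝ≥0∞)
    (hfg : ∀ m, ∫⁻ s, f s m ∂(μ.map (S i)) ≤ g m) :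
    ∫⁻ ω, f (S i ω) (profile (fun j => S j ω) R N i) ∂μ ≤
      ∫⁻ ω, g (profile (fun j => S j ω) R N i) ∂μ := by
  have hL := measurable_profile_comp hS R N i
  have hF : Measurable fun p : (ℕ → Bool) × ℕ => f p.1 p.2 :=
    measurable_from_prod_countable_left fun m => hf m
  have h1 := (ProbabilityTheory.indepFun_iff_map_prod_eq_prod_map_map (hS i).aemeasurable
    hL.aemeasurable).1 (indepFun_profile hS hind R N i)
  have : IsProbabilityMeasure (μ.map (S i)) := Measure.isProbabilityMeasure_map (hS i).aemeasurable
  have : IsProbabilityMeasure (μ.map fun ω => profile (fun j => S j ω) R N i) :=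
    Measure.isProbabilityMeasure_map hL.aemeasurable
  calc ∫⁻ ω, f (S i ω) (profile (fun j => S j ω) R N i) ∂μ
      = ∫⁻ p, f p.1 p.2 ∂(μ.map fun ω => (S i ω, profile (fun j => S j ω) R N i)) := by
        rw [lintegral_map hF ((hS i).prodMk hL)]
    _ = ∫⁻ m, ∫⁻ s, f s m ∂(μ.map (S i)) ∂(μ.map fun ω => profile (fun j => S j ω) R N i) := by
        rw [h1, lintegral_prod_symm' _ hF]
    _ ≤ ∫⁻ m, g m ∂(μ.map fun ω => profile (fun j => S j ω) R N i) := lintegral_mono hfg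
    _ = _ := lintegral_map measurable_from_top hL

lemma lintegral_profile_le {w : ℤ → ℝ} {C : ℝ} (hC : 0 ≤ C)
    (hstep : ∀ (P : Measure (ℕ → Bool)) [IsProbabilityMeasure P], IsStackLaw w P →
      ∀ m : ℕ, ∫⁻ s, ENNReal.ofReal (upsBefore s m) ∂P ≤ ENNReal.ofReal (m + C))
    (hS : ∀ i, Measurable (S i)) (hind : ProbabilityTheory.iIndepFun S μ)
    (hlaw : ∀ i, IsStackLaw w (μ.map (S i))) (R N i : ℕ) :
    ∫⁻ ω, ENNReal.ofReal (profile (fun j => S j ω) R N i) ∂μ ≤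
      ENNReal.ofReal (R + i * (C + 1)) := by
  induction i with
  | zero => simp [profile]
  | succ i ih =>
    have : IsProbabilityMeasure (μ.map (S i)) :=
      Measure.isProbabilityMeasure_map (hS i).aemeasurable
    have h := lintegral_profile_step hS hind R N i
      (fun s m => ENNReal.ofReal (upsBefore s m)) (fun m => (measurable_upsBefore_real m).ennreal_ofReal)
      (fun m => ENNReal.ofReal (m + C)) (fun m => hstep _ (hlaw i) m)
    have hm := measurable_profile_comp hS R N i
    have hm' : Measurable fun ω => ENNReal.ofReal (profile (fun j => S j ω) R N i : ℝ) :=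
      (measurable_from_top (f := fun k : ℕ => ENNReal.ofReal (k : ℝ))).comp hm
    have hm2 := measurable_upsBefore_uncurry.comp ((hS i).prodMk hm)
    have hm2' : Measurable fun ω =>
        ENNReal.ofReal (upsBefore (S i ω) (profile (fun j => S j ω) R N i) : ℝ) :=
      (measurable_from_top (f := fun k : ℕ => ENNReal.ofReal (k : ℝ))).comp hm2
    calc ∫⁻ ω, ENNReal.ofReal (profile (fun j => S j ω) R N (i + 1)) ∂μ
        ≤ ∫⁻ ω, (ENNReal.ofReal (upsBefore (S i ω) (profile (fun j => S j ω) R N i)) +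
            ENNReal.ofReal 1) ∂μ := by
          refine lintegral_mono fun ω => ?_
          rw [← ENNReal.ofReal_add (Nat.cast_nonneg _) zero_le_one]
          apply ENNReal.ofReal_le_ofReal
          rw [profile]
          split_ifs <;> simp
      _ = ∫⁻ ω, ENNReal.ofReal (upsBefore (S i ω) (profile (fun j => S j ω) R N i)) ∂μ +
            ENNReal.ofReal 1 := by
          rw [lintegral_add_right _ measurable_const]; simp
      _ ≤ ∫⁻ ω, (ENNReal.ofReal (profile (fun j => S j ω) R N i) + ENNReal.ofReal C) ∂μ +
            ENNReal.ofReal 1 := by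
          refine add_le_add (h.trans (le_of_eq (lintegral_congr fun ω => ?_))) le_rfl
          rw [ENNReal.ofReal_add (Nat.cast_nonneg _) hC]
      _ = ∫⁻ ω, ENNReal.ofReal (profile (fun j => S j ω) R N i) ∂μ + ENNReal.ofReal C +
            ENNReal.ofReal 1 := by
          rw [lintegral_add_right _ measurable_const]; simp
      _ ≤ ENNReal.ofReal (R + i * (C + 1)) + ENNReal.ofReal C + ENNReal.ofReal 1 := by gcongr
      _ = _ := by
          rw [← ENNReal.ofReal_add (by positivity) hC,
            ← ENNReal.ofReal_add (by positivity) zero_le_one]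
          congr 1; push_cast; ring

lemma lintegral_sq_profile_le {w : ℤ → ℝ} {δ C C' : ℝ} (hδ : 0 ≤ δ) (hC : 0 ≤ C) (hC' : 0 ≤ C')
    (hmean : ∀ (P : Measure (ℕ → Bool)) [IsProbabilityMeasure P], IsStackLaw w P →
      ∀ m : ℕ, ∫⁻ s, ENNReal.ofReal (upsBefore s m) ∂P ≤ ENNReal.ofReal (m + C))
    (hstep : ∀ (P : Measure (ℕ → Bool)) [IsProbabilityMeasure P], IsStackLaw w P →
      ∀ (m : ℕ) (a b : ℝ), 0 ≤ a → (b = a - 1 / 2 ∨ a = 0 ∧ b = 0) →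
      ∫⁻ s, ENNReal.ofReal (((upsBefore s m : ℝ) - b) ^ 2) ∂P ≤
        ENNReal.ofReal ((m - a) ^ 2 + δ * m + C'))
    (hS : ∀ i, Measurable (S i)) (hind : ProbabilityTheory.iIndepFun S μ)
    (hlaw : ∀ i, IsStackLaw w (μ.map (S i))) (R N i : ℕ) :
    ∫⁻ ω, ENNReal.ofReal (((profile (fun j => S j ω) R N i : ℝ) - profileMean R N i) ^ 2) ∂μ ≤
      ENNReal.ofReal (i * (δ * (R + i * (C + 1)) + C')) := by
  induction i with
  | zero => simp [profile, profileMean]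
  | succ i ih =>
    have : IsProbabilityMeasure (μ.map (S i)) :=
      Measure.isProbabilityMeasure_map (hS i).aemeasurable
    set b := profileMean R N (i + 1) - (if i < N then 1 else 0) with hb
    have h := lintegral_profile_step hS hind R N i
      (fun s m => ENNReal.ofReal (((upsBefore s m : ℝ) - b) ^ 2))
      (fun m => (((measurable_upsBefore_real m).sub_const _).pow_const 2).ennreal_ofReal)
      (fun m => ENNReal.ofReal ((m - profileMean R N i) ^ 2 + δ * m + C'))
      (fun m => hstep _ (hlaw i) m _ b (profileMean_nonneg R N i) (profileMean_succ R N i))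
    have hm := measurable_profile_comp hS R N i
    have hm' : Measurable fun ω => ENNReal.ofReal δ *
        ENNReal.ofReal (profile (fun j => S j ω) R N i : ℝ) :=
      (measurable_from_top (f := fun k : ℕ => ENNReal.ofReal δ * ENNReal.ofReal (k : ℝ))).comp hm
    calc ∫⁻ ω, ENNReal.ofReal
          (((profile (fun j => S j ω) R N (i + 1) : ℝ) - profileMean R N (i + 1)) ^ 2) ∂μ
        = ∫⁻ ω, ENNReal.ofReal
          (((upsBefore (S i ω) (profile (fun j => S j ω) R N i) : ℝ) - b) ^ 2) ∂μ := by
          refine lintegral_congr fun ω => ?_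
          rw [profile, hb]
          congr 2
          push_cast; ring
      _ ≤ _ := h
      _ = ∫⁻ ω, (ENNReal.ofReal
            (((profile (fun j => S j ω) R N i : ℝ) - profileMean R N i) ^ 2) +
            ENNReal.ofReal δ * ENNReal.ofReal (profile (fun j => S j ω) R N i) +
            ENNReal.ofReal C') ∂μ := by
          refine lintegral_congr fun ω => ?_
          rw [← ENNReal.ofReal_mul hδ, ← ENNReal.ofReal_add (sq_nonneg _) (by positivity),
            ← ENNReal.ofReal_add (by positivity) hC']
      _ = ∫⁻ ω, ENNReal.ofReal
            (((profile (fun j => S j ω) R N i : ℝ) - profileMean R N i) ^ 2) ∂μ +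
            ENNReal.ofReal δ * ∫⁻ ω, ENNReal.ofReal (profile (fun j => S j ω) R N i) ∂μ +
            ENNReal.ofReal C' := by
          rw [lintegral_add_right _ measurable_const, lintegral_add_right _ hm',
            lintegral_const_mul' _ _ ENNReal.ofReal_ne_top]
          simp
      _ ≤ ENNReal.ofReal (i * (δ * (R + i * (C + 1)) + C')) +
            ENNReal.ofReal δ * ENNReal.ofReal (R + i * (C + 1)) + ENNReal.ofReal C' := by
          gcongr
          exact lintegral_profile_le hC hmean hS hind hlaw R N i
      _ ≤ _ := by
          rw [← ENNReal.ofReal_mul hδ, ← ENNReal.ofReal_add (by positivity) (by positivity),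
            ← ENNReal.ofReal_add (by positivity) hC']
          apply ENNReal.ofReal_le_ofReal
          push_cast
          have : 0 ≤ (i + 1) * (δ * (C + 1)) := by positivity
          nlinarith

lemma measure_profile_ne_zero_le {w : ℤ → ℝ} {κ : ℝ}
    (hstep : ∀ (P : Measure (ℕ → Bool)) [IsProbabilityMeasure P], IsStackLaw w P →
      ∀ m : ℕ, ∫⁻ s, ENNReal.ofReal (lyap κ (upsBefore s m)) ∂P +
        (if m = 0 then 0 else ENNReal.ofReal (1 / 4)) ≤ ENNReal.ofReal (lyap κ m))
    (hS : ∀ i, Measurable (S i)) (hind : ProbabilityTheory.iIndepFun S μ)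
    (hlaw : ∀ i, IsStackLaw w (μ.map (S i))) (R N i : ℕ) (hi : N ≤ i) (n : ℕ) :
    n * ENNReal.ofReal (1 / 4) * μ {ω | profile (fun j => S j ω) R N (i + n) ≠ 0} ≤
      ∫⁻ ω, ENNReal.ofReal (lyap κ (profile (fun j => S j ω) R N i)) ∂μ := by
  have hms : ∀ k, MeasurableSet {ω | profile (fun j => S j ω) R N k ≠ 0} := fun k =>
    (measurable_profile_comp hS R N k) (measurableSet_singleton 0).compl
  have key : ∀ n, ∫⁻ ω, ENNReal.ofReal (lyap κ (profile (fun j => S j ω) R N (i + n))) ∂μ +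
      n * ENNReal.ofReal (1 / 4) * μ {ω | profile (fun j => S j ω) R N (i + n) ≠ 0} ≤
      ∫⁻ ω, ENNReal.ofReal (lyap κ (profile (fun j => S j ω) R N i)) ∂μ := by
    intro n
    induction n with
    | zero => simp
    | succ n ih =>
      refine le_trans ?_ ih
      have : IsProbabilityMeasure (μ.map (S (i + n))) :=
        Measure.isProbabilityMeasure_map (hS _).aemeasurable
      have h := lintegral_profile_step hS hind R N (i + n)
        (fun s m => ENNReal.ofReal (lyap κ (upsBefore s m)) +
          (if m = 0 then 0 else ENNReal.ofReal (1 / 4)))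
        (fun m => ((measurable_from_top (f := fun k : ℕ => ENNReal.ofReal (lyap κ k))).comp
          (measurable_upsBefore m)).add_const _)
        (fun m => ENNReal.ofReal (lyap κ m))
        (fun m => by
          rw [lintegral_add_right _ measurable_const, lintegral_const, measure_univ, mul_one]
          exact hstep _ (hlaw _) m)
      have hind0 : ∀ ω, (if profile (fun j => S j ω) R N (i + n) = 0 then (0 : ℝ≥0∞) else
          ENNReal.ofReal (1 / 4)) = {ω | profile (fun j => S j ω) R N (i + n) ≠ 0}.indicator
            (fun _ => ENNReal.ofReal (1 / 4)) ω := fun ω => by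
        by_cases h0 : profile (fun j => S j ω) R N (i + n) = 0 <;> simp [h0]
      simp_rw [hind0] at h
      rw [lintegral_add_right _ (measurable_const.indicator (hms _)),
        lintegral_indicator_const (hms _)] at h
      have hsucc : ∀ ω, profile (fun j => S j ω) R N (i + (n + 1)) =
          upsBefore (S (i + n) ω) (profile (fun j => S j ω) R N (i + n)) := fun ω => by
        rw [← add_assoc, profile, if_neg (by omega), add_zero]
      have hsub : μ {ω | profile (fun j => S j ω) R N (i + (n + 1)) ≠ 0} ≤
          μ {ω | profile (fun j => S j ω) R N (i + n) ≠ 0} := by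
        refine measure_mono fun ω hω => ?_
        simp only [Set.mem_ofPred_eq] at hω ⊢
        intro h0
        rw [hsucc, h0, upsBefore_zero] at hω
        exact hω rfl
      simp_rw [← hsucc] at h
      calc _ ≤ ∫⁻ ω, ENNReal.ofReal (lyap κ (profile (fun j => S j ω) R N (i + (n + 1)))) ∂μ +
            ((n + 1 : ℕ) : ℝ≥0∞) * ENNReal.ofReal (1 / 4) *
              μ {ω | profile (fun j => S j ω) R N (i + n) ≠ 0} := by gcongr
        _ = (∫⁻ ω, ENNReal.ofReal (lyap κ (profile (fun j => S j ω) R N (i + (n + 1)))) ∂μ +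
            ENNReal.ofReal (1 / 4) * μ {ω | profile (fun j => S j ω) R N (i + n) ≠ 0}) +
            n * ENNReal.ofReal (1 / 4) * μ {ω | profile (fun j => S j ω) R N (i + n) ≠ 0} := by
          push_cast; ring
        _ ≤ _ := by gcongr
  exact le_add_self.trans (key n)

end Chain

/-- `S` is a sequence of independent stacks with the stack law of weight `w`. -/
structure IsStackSeq (w : ℤ → ℝ) {Ω : Type*} [MeasurableSpace Ω] (μ : Measure Ω)
    (S : ℕ → Ω → ℕ → Bool) : Prop where
  meas : ∀ i, Measurable (S i)
  indep : ProbabilityTheory.iIndepFun S μ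
  law : ∀ i, IsStackLaw w (μ.map (S i))

lemma measure_lt_sum_abs_le {Ω : Type*} [MeasurableSpace Ω] (μ : Measure Ω) (D : ℕ → Ω → ℝ)
    (hD : ∀ i, Measurable (D i)) (K : ℕ) {q t : ℝ} (hq : 0 ≤ q) (ht : 0 < t)
    (h : ∀ i < K, ∫⁻ ω, ENNReal.ofReal (D i ω ^ 2) ∂μ ≤ ENNReal.ofReal q) :
    μ {ω | t < ∑ i ∈ Finset.range K, |D i ω|} ≤ ENNReal.ofReal (K ^ 2 * q / t ^ 2) := by
  have hm : ∀ i, Measurable fun ω => ENNReal.ofReal (D i ω ^ 2) := fun i =>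
    ((hD i).pow_const 2).ennreal_ofReal
  have h1 : ∫⁻ ω, ENNReal.ofReal (K * ∑ i ∈ Finset.range K, D i ω ^ 2) ∂μ ≤
      ENNReal.ofReal (K ^ 2 * q) := by
    calc ∫⁻ ω, ENNReal.ofReal (K * ∑ i ∈ Finset.range K, D i ω ^ 2) ∂μ
        = ∫⁻ ω, ENNReal.ofReal K * ∑ i ∈ Finset.range K, ENNReal.ofReal (D i ω ^ 2) ∂μ := by
          refine lintegral_congr fun ω => ?_
          rw [ENNReal.ofReal_mul (Nat.cast_nonneg _),
            ENNReal.ofReal_sum_of_nonneg fun i _ => sq_nonneg _]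
      _ = ENNReal.ofReal K * ∑ i ∈ Finset.range K, ∫⁻ ω, ENNReal.ofReal (D i ω ^ 2) ∂μ := by
          rw [lintegral_const_mul' _ _ ENNReal.ofReal_ne_top, lintegral_finsetSum _ fun i _ => hm i]
      _ ≤ ENNReal.ofReal K * ∑ i ∈ Finset.range K, ENNReal.ofReal q := by
          gcongr with i hi
          exact h i (Finset.mem_range.1 hi)
      _ = _ := by
          rw [← ENNReal.ofReal_sum_of_nonneg fun i _ => hq, ← ENNReal.ofReal_mul (Nat.cast_nonneg _)]
          simp; ring_nf
  have h2 : {ω | t < ∑ i ∈ Finset.range K, |D i ω|} ⊆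
      {ω | ENNReal.ofReal (t ^ 2) ≤ ENNReal.ofReal (K * ∑ i ∈ Finset.range K, D i ω ^ 2)} := by
    intro ω hω
    simp only [Set.mem_ofPred_eq] at hω ⊢
    apply ENNReal.ofReal_le_ofReal
    have := sq_sum_le_card_mul_sum_sq (s := Finset.range K) (f := fun i => |D i ω|)
    simp only [sq_abs, Finset.card_range] at this
    exact (pow_le_pow_left₀ ht.le hω.le 2).trans this
  have ht2 : 0 < t ^ 2 := by positivity
  refine (measure_mono h2).trans ((meas_ge_le_lintegral_div ?_ ?_ ENNReal.ofReal_ne_top).trans ?_)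
  · exact ((Finset.measurable_sum _ fun i _ => (hD i).pow_const 2).const_mul
      _).ennreal_ofReal.aemeasurable
  · simpa using ht.ne'
  · rw [ENNReal.ofReal_div_of_pos ht2]
    gcongr

lemma lintegral_lyap_le {Ω : Type*} [MeasurableSpace Ω] (μ : Measure Ω) [IsProbabilityMeasure μ]
    {L : Ω → ℕ} {κ c q : ℝ} (hκ : 0 ≤ κ) (hc : 0 < c) (hq : 0 ≤ q)
    (h : ∫⁻ ω, ENNReal.ofReal ((L ω : ℝ) ^ 2) ∂μ ≤ ENNReal.ofReal q) :
    ∫⁻ ω, ENNReal.ofReal (lyap κ (L ω)) ∂μ ≤ ENNReal.ofReal (c + q / c + κ) := by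
  have hl : ∀ m : ℕ, lyap κ m ≤ c⁻¹ * (m : ℝ) ^ 2 + (c + κ) := by
    intro m
    have h1 : (m : ℝ) ≤ c⁻¹ * m ^ 2 + c := by
      rw [← sub_nonneg]
      have : c⁻¹ * (m : ℝ) ^ 2 + c - m = c⁻¹ * ((m - c / 2) ^ 2 + 3 / 4 * c ^ 2) := by
        field_simp; ring
      rw [this]; positivity
    unfold lyap
    split_ifs <;> linarith
  calc _ ≤ ∫⁻ ω, (ENNReal.ofReal c⁻¹ * ENNReal.ofReal ((L ω : ℝ) ^ 2) +
        ENNReal.ofReal (c + κ)) ∂μ := by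
        refine lintegral_mono fun ω => ?_
        rw [← ENNReal.ofReal_mul (by positivity), ← ENNReal.ofReal_add (by positivity)
          (by positivity)]
        exact ENNReal.ofReal_le_ofReal (hl _)
    _ = ENNReal.ofReal c⁻¹ * ∫⁻ ω, ENNReal.ofReal ((L ω : ℝ) ^ 2) ∂μ +
        ENNReal.ofReal (c + κ) := by
        rw [lintegral_add_right _ measurable_const,
          lintegral_const_mul' _ _ ENNReal.ofReal_ne_top]
        simp
    _ ≤ ENNReal.ofReal c⁻¹ * ENNReal.ofReal q + ENNReal.ofReal (c + κ) := by gcongr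
    _ = _ := by
        rw [← ENNReal.ofReal_mul (by positivity), ← ENNReal.ofReal_add (by positivity)
          (by positivity)]
        congr 1
        field_simp; ring

theorem exists_profile_estimate {w : ℤ → ℝ} (hw : GoodWeight w) {M ε : ℝ} (hM : 0 < M)
    (hε : 0 < ε) :
    ∃ n₀ : ℕ, ∀ n ≥ n₀, ∀ {Ω : Type} [MeasurableSpace Ω] (μ : Measure Ω) [IsProbabilityMeasure μ]
      (S : ℕ → Ω → ℕ → Bool), IsStackSeq w μ S → ∀ R N : ℕ, (R : ℝ) ≤ M * n → (N : ℝ) ≤ M * n →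
      μ {ω | profile (fun j => S j ω) R N (2 * R + 2 * N + n) ≠ 0} ≤ ENNReal.ofReal ε ∧
      μ {ω | ε * n ^ 2 < |(∑ i ∈ Finset.range (2 * R + 2 * N + n),
          (profile (fun j => S j ω) R N i : ℝ)) - (R ^ 2 + 2 * R * N + N ^ 2 / 2)|} ≤
        ENNReal.ofReal ε := by
  obtain ⟨C₁, hC₁, hmean⟩ := exists_mean_step hw
  obtain ⟨κ, hκ, hlyap⟩ := exists_lyap_step hw
  set B : ℝ := 4 * M + 1 with hB
  set B' : ℝ := M + B * (C₁ + 1) with hB'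
  have hB0 : 0 < B := by positivity
  have hB'0 : 0 < B' := by positivity
  set η : ℝ := ε / 16 with hη
  have hη0 : 0 < η := by positivity
  set δ : ℝ := min (ε * η / (16 * B * B')) (ε ^ 3 / (8 * B ^ 3 * B')) with hδ
  have hδ0 : 0 < δ := lt_min (by positivity) (by positivity)
  have hδ1 : 4 * B * B' * δ / η ≤ ε / 4 := by
    have : δ ≤ ε * η / (16 * B * B') := min_le_left _ _
    rw [div_le_iff₀ hη0]
    rw [le_div_iff₀ (by positivity)] at this
    linarith
  have hδ2 : 4 * B ^ 3 * B' * δ / ε ^ 2 ≤ ε / 2 := by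
    have : δ ≤ ε ^ 3 / (8 * B ^ 3 * B') := min_le_right _ _
    rw [div_le_iff₀ (by positivity)]
    rw [le_div_iff₀ (by positivity)] at this
    nlinarith
  obtain ⟨C₂, hC₂, hsq⟩ := exists_sq_step hw hδ0
  have hlim : ∀ c : ℝ, ∀ᶠ n : ℕ in atTop, c ≤ n * (ε / 2) := fun c =>
    (tendsto_natCast_atTop_atTop.atTop_mul_const (half_pos hε)).eventually_ge_atTop c
  obtain ⟨n₀, hn₀⟩ := eventually_atTop.1 ((eventually_ge_atTop 1).and
    ((hlim (4 * B * C₂ / η + 4 * κ)).and ((hlim (4 * B ^ 3 * C₂ / ε ^ 2)).and (hlim (B / 4)))))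
  refine ⟨n₀, fun n hn Ω _ μ _ S hS R N hR hN => ?_⟩
  obtain ⟨hn1, hna, hnb, hnc⟩ := hn₀ n hn
  have hn0 : (0 : ℝ) < n := by exact_mod_cast hn1
  have hn1' : (1 : ℝ) ≤ n := by exact_mod_cast hn1
  set K := 2 * R + 2 * N + n with hK
  have hKB : (K : ℝ) ≤ B * n := by rw [hK, hB]; push_cast; linarith
  set q : ℝ := B * n * (δ * (B' * n) + C₂) with hq
  have hq0 : 0 ≤ q := by positivity
  have hQ : ∀ i ≤ K, ∫⁻ ω, ENNReal.ofReal
      (((profile (fun j => S j ω) R N i : ℝ) - profileMean R N i) ^ 2) ∂μ ≤ ENNReal.ofReal q := by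
    intro i hi
    have hi' : (i : ℝ) ≤ B * n := le_trans (by exact_mod_cast hi) hKB
    refine (lintegral_sq_profile_le hδ0.le hC₁ hC₂ hmean hsq hS.meas hS.indep hS.law R N i).trans
      (ENNReal.ofReal_le_ofReal ?_)
    have h1 : (R : ℝ) + i * (C₁ + 1) ≤ B' * n := by
      have : (i : ℝ) * (C₁ + 1) ≤ B * n * (C₁ + 1) := by gcongr
      rw [hB']
      linarith
    rw [hq]
    gcongr
  constructor
  · have h1 := hQ (2 * R + 2 * N) (by omega)
    simp_rw [profileMean_eq_zero le_rfl, sub_zero] at h1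
    have h2 := lintegral_lyap_le μ hκ (mul_pos hη0 hn0) hq0 h1
    have h3 := (measure_profile_ne_zero_le hlyap hS.meas hS.indep hS.law R N (2 * R + 2 * N)
      (by omega) n).trans h2
    have h4 : (n : ℝ≥0∞) * ENNReal.ofReal (1 / 4) = ENNReal.ofReal (n / 4) := by
      rw [← ENNReal.ofReal_natCast, ← ENNReal.ofReal_mul (Nat.cast_nonneg _)]
      congr 1; ring
    have h5 : 0 < (n : ℝ) / 4 := by positivity
    rw [h4, mul_comm, ← ENNReal.le_div_iff_mul_le (by simp [h5]) (by simp),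
      ← ENNReal.ofReal_div_of_pos h5] at h3
    refine h3.trans (ENNReal.ofReal_le_ofReal ?_)
    have h6 : (η * n + q / (η * n) + κ) / (n / 4) =
        4 * η + 4 * B * B' * δ / η + (4 * B * C₂ / η + 4 * κ) / n := by
      rw [hq]; field_simp; ring
    have h7 : (4 * B * C₂ / η + 4 * κ) / n ≤ ε / 2 := by
      rw [div_le_iff₀ hn0]; linarith
    rw [h6]
    linarith
  · have ht : 0 < ε * n ^ 2 / 2 := by positivity
    have h1 := measure_lt_sum_abs_le μ
      (fun i ω => (profile (fun j => S j ω) R N i : ℝ) - profileMean R N i)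
      (fun i => (measurable_from_top (f := fun k : ℕ => (k : ℝ) - profileMean R N i)).comp
        (measurable_profile_comp hS.meas R N i)) K hq0 ht (fun i hi => hQ i hi.le)
    refine (measure_mono fun ω hω => ?_).trans (h1.trans (ENNReal.ofReal_le_ofReal ?_))
    · simp only [Set.mem_ofPred_eq] at hω ⊢
      have h2 := abs_sum_profileMean_sub_le R N K (by omega)
      have h3 := Finset.abs_sum_le_sum_abs
        (fun i => (profile (fun j => S j ω) R N i : ℝ) - profileMean R N i) (Finset.range K)
      rw [Finset.sum_sub_distrib] at h3
      have h4 := abs_add_le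
        ((∑ i ∈ Finset.range K, (profile (fun j => S j ω) R N i : ℝ)) -
          ∑ i ∈ Finset.range K, profileMean R N i)
        ((∑ i ∈ Finset.range K, profileMean R N i) - (R ^ 2 + 2 * R * N + N ^ 2 / 2 : ℝ))
      rw [sub_add_sub_cancel] at h4
      have h5 : (K : ℝ) / 4 ≤ ε * n ^ 2 / 2 := by nlinarith
      linarith
    · calc (K : ℝ) ^ 2 * q / (ε * n ^ 2 / 2) ^ 2
          ≤ (B * n) ^ 2 * q / (ε * n ^ 2 / 2) ^ 2 := by gcongr
        _ = 4 * B ^ 3 * B' * δ / ε ^ 2 + 4 * B ^ 3 * C₂ / ε ^ 2 / n := by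
          rw [hq]; field_simp; norm_num
        _ ≤ ε / 2 + ε / 2 := by
          have : 4 * B ^ 3 * C₂ / ε ^ 2 / n ≤ ε / 2 := by
            rw [div_le_iff₀ hn0]; linarith
          exact add_le_add hδ2 this
        _ = ε := by ring

/-- The first letters of the stack generated by the uniform variables `u`. -/
def drivenWord (w : ℤ → ℝ) (u : ℕ → ℝ) : ℕ → List Bool
  | 0 => []
  | n + 1 => drivenWord w u n ++ [decide (u n < upProb w (excess (drivenWord w u n)))]

/-- The stack generated by the uniform variables `u`. -/
def drivenStack (w : ℤ → ℝ) (u : ℕ → ℝ) (n : ℕ) : Bool :=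
  decide (u n < upProb w (excess (drivenWord w u n)))

/-- The uniform values producing the letter `b` after the word `l`. -/
def letterSet (w : ℤ → ℝ) (l : List Bool) (b : Bool) : Set ℝ :=
  if b then Set.Iio (upProb w (excess l)) else Set.Ici (upProb w (excess l))

lemma measurableSet_letterSet (w : ℤ → ℝ) (l : List Bool) (b : Bool) :
    MeasurableSet (letterSet w l b) := by
  unfold letterSet; split_ifs
  · exact measurableSet_Iio
  · exact measurableSet_Ici

/-- The uniform distribution on the unit interval. -/
def uniformLaw : Measure ℝ := volume.restrict (Set.Icc 0 1)

instance : IsProbabilityMeasure uniformLaw := ⟨by simp [uniformLaw]⟩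

lemma uniformLaw_letterSet {w : ℤ → ℝ} (hw : ∀ z, 0 < w z) (l : List Bool) (b : Bool) :
    uniformLaw (letterSet w l b) = ENNReal.ofReal (letterProb w l b) := by
  have h0 := upProb_pos hw (excess l)
  have h1 := upProb_pos hw (-excess l)
  have h2 := upProb_add_neg hw (excess l)
  rw [uniformLaw, Measure.restrict_apply (measurableSet_letterSet w l b)]
  cases b
  · have : letterSet w l false ∩ Set.Icc 0 1 = Set.Icc (upProb w (excess l)) 1 := by
      ext x; simp only [letterSet, Bool.false_eq_true, if_false, Set.mem_inter_iff, Set.mem_Ici,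
        Set.mem_Icc]
      constructor
      · rintro ⟨a, b, c⟩; exact ⟨a, c⟩
      · rintro ⟨a, c⟩; exact ⟨a, by linarith, c⟩
    rw [this, Real.volume_Icc]
    congr 1; simp only [letterProb, Bool.false_eq_true, if_false]; linarith
  · have : letterSet w l true ∩ Set.Icc 0 1 = Set.Ico 0 (upProb w (excess l)) := by
      ext x; simp only [letterSet, if_true, Set.mem_inter_iff, Set.mem_Iio,
        Set.mem_Icc, Set.mem_Ico]
      constructor
      · rintro ⟨a, b, c⟩; exact ⟨b, a⟩
      · rintro ⟨a, c⟩; exact ⟨c, a, by linarith⟩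
    rw [this, Real.volume_Ico]
    simp [letterProb]

lemma steps_drivenStack (w : ℤ → ℝ) (u : ℕ → ℝ) (n : ℕ) :
    steps (drivenStack w u) n = drivenWord w u n := by
  induction n with
  | zero => rfl
  | succ n ih => rw [steps_succ, ih]; rfl

lemma mem_letterSet {w : ℤ → ℝ} {l : List Bool} {b : Bool} {x : ℝ} :
    x ∈ letterSet w l b ↔ decide (x < upProb w (excess l)) = b := by
  cases b <;> simp [letterSet]

lemma mem_stackCyl_append (s : ℕ → Bool) (l : List Bool) (b : Bool) :
    s ∈ stackCyl (l ++ [b]) ↔ s ∈ stackCyl l ∧ s l.length = b := by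
  simp only [stackCyl, Set.mem_ofPred_eq, List.length_append, List.length_singleton, steps_succ]
  constructor
  · intro h
    have := List.append_inj h (by simp)
    exact ⟨this.1, by simpa using this.2⟩
  · rintro ⟨h1, h2⟩; rw [h1, h2]

lemma preimage_drivenStack_stackCyl (w : ℤ → ℝ) (l : List Bool) :
    drivenStack w ⁻¹' stackCyl l = Set.pi (Finset.range l.length : Finset ℕ)
      (fun i => letterSet w (l.take i) (l.getD i false)) := by
  induction l using List.reverseRecOn with
  | nil => ext u; simp [stackCyl]
  | append_singleton l b ih =>
    ext u
    have ih' := Set.ext_iff.1 ih u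
    simp only [Set.mem_preimage, Set.mem_pi, Finset.coe_range, Set.mem_Iio] at ih' ⊢
    rw [mem_stackCyl_append, List.length_append, List.length_singleton]
    simp only [Nat.lt_succ_iff_lt_or_eq, or_imp, forall_and, forall_eq]
    have e1 : (∀ x < l.length, u x ∈ letterSet w (List.take x (l ++ [b]))
        ((l ++ [b]).getD x false)) ↔
        ∀ x < l.length, u x ∈ letterSet w (l.take x) (l.getD x false) :=
      forall₂_congr fun x hx => by
        rw [List.take_append_of_le_length hx.le, List.getD_append _ _ _ _ hx]
    have e2 : (l ++ [b]).getD l.length false = b := by simp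
    rw [e1, List.take_left, e2, ← ih', mem_letterSet]
    refine and_congr_right fun h => ?_
    have h' : drivenWord w u l.length = l := by
      rw [← steps_drivenStack]; exact h
    rw [drivenStack, h']

lemma measurable_drivenStack (w : ℤ → ℝ) : Measurable (drivenStack w) := by
  let _ : MeasurableSpace (List Bool) := ⊤
  have hF : Measurable fun p : List Bool × ℝ => decide (p.2 < upProb w (excess p.1)) := by
    refine measurable_from_prod_countable_right fun l => ?_
    refine measurable_to_bool ?_
    have : (fun x : ℝ => decide (x < upProb w (excess l))) ⁻¹' {true} =
        Set.Iio (upProb w (excess l)) := by ext x; simp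
    rw [this]
    exact measurableSet_Iio
  have hw : ∀ n, Measurable fun u => drivenWord w u n := by
    intro n
    induction n with
    | zero => exact measurable_const
    | succ n ih =>
      have h1 := hF.comp (ih.prodMk (measurable_pi_apply n))
      have h2 := (measurable_from_top (f := fun b : Bool => [b])).comp h1
      exact (measurable_from_prod_countable_left (f := fun p : List Bool × List Bool => p.1 ++ p.2)
        (fun _ => measurable_from_top)).comp (ih.prodMk h2)
  exact measurable_pi_lambda _ fun n => hF.comp ((hw n).prodMk (measurable_pi_apply n))

/-- The stack law of weight `w`. -/
def stackLaw (w : ℤ → ℝ) : Measure (ℕ → Bool) :=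
  (Measure.infinitePi fun _ : ℕ => uniformLaw).map (drivenStack w)

instance (w : ℤ → ℝ) : IsProbabilityMeasure (stackLaw w) :=
  Measure.isProbabilityMeasure_map (measurable_drivenStack w).aemeasurable

lemma isStackLaw_stackLaw {w : ℤ → ℝ} (hw : ∀ z, 0 < w z) : IsStackLaw w (stackLaw w) := by
  intro l b
  have key : ∀ l : List Bool, stackLaw w (stackCyl l) = ∏ i ∈ Finset.range l.length,
      uniformLaw (letterSet w (l.take i) (l.getD i false)) := fun l => by
    rw [stackLaw, Measure.map_apply (measurable_drivenStack w) (measurableSet_stackCyl l),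
      preimage_drivenStack_stackCyl, Measure.infinitePi_pi _ fun i _ => measurableSet_letterSet _ _ _]
  rw [key, key, List.length_append, List.length_singleton, Finset.prod_range_succ]
  congr 1
  · refine Finset.prod_congr rfl fun i hi => ?_
    rw [Finset.mem_range] at hi
    rw [List.take_append_of_le_length hi.le, List.getD_append _ _ _ _ hi]
  · rw [List.take_left, ← uniformLaw_letterSet hw]
    simp

/-- Position and numbers of past visits of the walk following the stacks `σ`. -/
def walkState (σ : ℤ → ℕ → Bool) : ℕ → ℤ × (ℤ → ℕ)
  | 0 => (0, 0)
  | n + 1 => (if σ (walkState σ n).1 ((walkState σ n).2 (walkState σ n).1) then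
      (walkState σ n).1 + 1 else (walkState σ n).1 - 1,
      fun k => (walkState σ n).2 k + if k = (walkState σ n).1 then 1 else 0)

/-- Position of the walk following the stacks `σ`. -/
def walkPos (σ : ℤ → ℕ → Bool) (n : ℕ) : ℤ := (walkState σ n).1

/-- Number of departures from `k` before time `n`. -/
def visits (σ : ℤ → ℕ → Bool) (n : ℕ) (k : ℤ) : ℕ := (walkState σ n).2 k

@[simp] lemma walkPos_zero (σ : ℤ → ℕ → Bool) : walkPos σ 0 = 0 := rfl

@[simp] lemma visits_zero (σ : ℤ → ℕ → Bool) (k : ℤ) : visits σ 0 k = 0 := rfl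

lemma walkPos_succ (σ : ℤ → ℕ → Bool) (n : ℕ) : walkPos σ (n + 1) =
    if σ (walkPos σ n) (visits σ n (walkPos σ n)) then walkPos σ n + 1 else walkPos σ n - 1 := rfl

lemma visits_succ (σ : ℤ → ℕ → Bool) (n : ℕ) (k : ℤ) : visits σ (n + 1) k =
    visits σ n k + if k = walkPos σ n then 1 else 0 := rfl

lemma dirLocP_succ (x : ℕ → ℤ) (n : ℕ) (k : ℤ) : dirLocP x (n + 1) k =
    dirLocP x n k + if x n = k ∧ x (n + 1) = k + 1 then 1 else 0 := by
  unfold dirLocP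
  rw [Finset.range_add_one, Finset.filter_insert]
  split_ifs with h
  · rw [Finset.card_insert_of_notMem (by simp)]
  · simp

lemma dirLocM_succ (x : ℕ → ℤ) (n : ℕ) (k : ℤ) : dirLocM x (n + 1) k =
    dirLocM x n k + if x n = k ∧ x (n + 1) = k - 1 then 1 else 0 := by
  unfold dirLocM
  rw [Finset.range_add_one, Finset.filter_insert]
  split_ifs with h
  · rw [Finset.card_insert_of_notMem (by simp)]
  · simp

lemma dirLocP_walkPos (σ : ℤ → ℕ → Bool) (n : ℕ) (k : ℤ) :
    dirLocP (walkPos σ) n k = numUp (σ k) (visits σ n k) := by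
  induction n with
  | zero => simp [dirLocP]
  | succ n ih =>
    rw [dirLocP_succ, ih, visits_succ, walkPos_succ]
    by_cases hk : k = walkPos σ n
    · rw [if_pos hk, numUp_succ, ← hk]
      cases σ k (visits σ n k) <;> simp
      omega
    · rw [if_neg hk, if_neg (fun h => hk h.1.symm)]; rfl

lemma dirLocM_walkPos (σ : ℤ → ℕ → Bool) (n : ℕ) (k : ℤ) :
    dirLocM (walkPos σ) n k = numDown (σ k) (visits σ n k) := by
  induction n with
  | zero => simp [dirLocM]
  | succ n ih =>
    rw [dirLocM_succ, ih, visits_succ, walkPos_succ]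
    by_cases hk : k = walkPos σ n
    · rw [if_pos hk, numDown_succ, ← hk]
      cases σ k (visits σ n k) <;> simp
      omega
    · rw [if_neg hk, if_neg (fun h => hk h.1.symm)]; rfl

/-- Net number of crossings of the edge `{k, k + 1}` by a path from `0` to `e`. -/
def netFlow (e k : ℤ) : ℤ :=
  (if 0 ≤ k ∧ k < e then 1 else 0) - (if e ≤ k ∧ k < 0 then 1 else 0)

lemma netFlow_zero (k : ℤ) : netFlow 0 k = 0 := by
  unfold netFlow; split_ifs <;> omega

lemma netFlow_add_one (e k : ℤ) : netFlow (e + 1) k = netFlow e k + if k = e then 1 else 0 := by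
  unfold netFlow; split_ifs <;> omega

lemma numUp_sub_numDown_visits (σ : ℤ → ℕ → Bool) (n : ℕ) (k : ℤ) :
    (numUp (σ k) (visits σ n k) : ℤ) - numDown (σ (k + 1)) (visits σ n (k + 1)) =
      netFlow (walkPos σ n) k := by
  rw [← dirLocP_walkPos, ← dirLocM_walkPos]
  induction n with
  | zero => simp [dirLocP, dirLocM, netFlow_zero]
  | succ n ih =>
    rw [dirLocP_succ, dirLocM_succ, walkPos_succ]
    generalize walkPos σ n = p at *
    cases σ p (visits σ n p)
    · have := netFlow_add_one (p - 1) k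
      rw [sub_add_cancel] at this
      simp only [Bool.false_eq_true, if_false]
      push_cast
      split_ifs at * <;> omega
    · have := netFlow_add_one p k
      simp only [if_true]
      push_cast
      split_ifs at * <;> omega

/-- `a` and `b` are the numbers of up and down steps of the walk following `σ`, at the time when it
has used up all instructions of a flow from `0` to `e` directed towards the edge `{c, c + 1}`. -/
structure IsFlow (σ : ℤ → ℕ → Bool) (c e : ℤ) (a b : ℤ → ℕ) : Prop where
  up : ∀ k, numUp (σ k) (a k + b k) = a k
  bal : ∀ k, (a k : ℤ) - b (k + 1) = netFlow e k
  left : ∀ k ≤ c, ∀ m < a k + b k, numUp (σ k) m < a k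
  right : ∀ k, c < k → ∀ m < a k + b k, numDown (σ k) m < b k
  target : e = c ∨ e = c + 1

namespace IsFlow
variable {σ : ℤ → ℕ → Bool} {c e : ℤ} {a b : ℤ → ℕ}

lemma down (h : IsFlow σ c e a b) (k : ℤ) : numDown (σ k) (a k + b k) = b k := by
  have := numUp_add_numDown (σ k) (a k + b k)
  rw [h.up] at this
  omega

lemma visits_eq (h : IsFlow σ c e a b) {n : ℕ} (hn : walkPos σ n = e)
    (hle : ∀ k, visits σ n k ≤ a k + b k) (hc : numUp (σ c) (visits σ n c) = a c) (k : ℤ) :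
    visits σ n k = a k + b k := by
  have hr : ∀ i : ℕ, visits σ n (c + 1 + i) = a (c + 1 + i) + b (c + 1 + i) := by
    have key : ∀ k, c ≤ k → numUp (σ k) (visits σ n k) = a k →
        visits σ n (k + 1) = a (k + 1) + b (k + 1) := by
      intro k hk h1
      have h2 := numUp_sub_numDown_visits σ n k
      have h3 := h.bal k
      rw [hn] at h2
      by_contra h4
      have h5 := h.right (k + 1) (by omega) _ (lt_of_le_of_ne (hle _) h4)
      omega
    intro i
    induction i with
    | zero => simpa using key c le_rfl hc
    | succ i ih =>
      have := key (c + 1 + i) (by omega) (by rw [ih, h.up])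
      push_cast
      rwa [← add_assoc]
  have hl : ∀ i : ℕ, visits σ n (c - i) = a (c - i) + b (c - i) := by
    have key : ∀ k, k ≤ c → numUp (σ k) (visits σ n k) = a k →
        visits σ n k = a k + b k := by
      intro k hk h1
      by_contra h4
      have h5 := h.left k hk _ (lt_of_le_of_ne (hle _) h4)
      omega
    intro i
    induction i with
    | zero => simpa using key c le_rfl hc
    | succ i ih =>
      refine key _ (by omega) ?_
      have h2 := numUp_sub_numDown_visits σ n (c - (i + 1 : ℕ))
      have h3 := h.bal (c - (i + 1 : ℕ))
      have e1 : c - ((i + 1 : ℕ) : ℤ) + 1 = c - i := by push_cast; ring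
      rw [hn, e1, ih, h.down] at h2
      rw [e1] at h3
      omega
  rcases le_or_gt k c with hk | hk
  · have := hl (c - k).toNat
    rwa [show c - ((c - k).toNat : ℤ) = k by omega] at this
  · have := hr (k - (c + 1)).toNat
    rwa [show c + 1 + ((k - (c + 1)).toNat : ℤ) = k by omega] at this

lemma visits_succ_le (h : IsFlow σ c e a b) {n : ℕ} (hle : ∀ k, visits σ n k ≤ a k + b k)
    (hne : ∃ k, visits σ n k ≠ a k + b k) (k : ℤ) : visits σ (n + 1) k ≤ a k + b k := by
  rw [visits_succ]
  split_ifs with hk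
  swap
  · exact hle k
  by_contra! hlt
  have hv : visits σ n k = a k + b k := le_antisymm (hle k) (by omega)
  have hup : ∀ k, numUp (σ k) (visits σ n k) ≤ a k := fun k => by
    have := numUp_mono (σ k) (hle k)
    rwa [h.up] at this
  have hdn : ∀ k, numDown (σ k) (visits σ n k) ≤ b k := fun k => by
    have := numDown_mono (σ k) (hle k)
    rwa [h.down] at this
  have h1 := numUp_sub_numDown_visits σ n k
  have h2 := numUp_sub_numDown_visits σ n (k - 1)
  have h3 := h.bal k
  have h4 := h.bal (k - 1)
  have h5 := hdn (k + 1)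
  have h6 := hup (k - 1)
  rw [hv, h.up, ← hk] at h1
  rw [sub_add_cancel, hv, h.down, ← hk] at h2
  rw [sub_add_cancel] at h4
  have h7 : netFlow e k ≤ netFlow k k := by omega
  have h8 : netFlow k (k - 1) ≤ netFlow e (k - 1) := by omega
  have h9 : k = e := by
    unfold netFlow at h7 h8
    split_ifs at h7 h8 <;> omega
  subst h9
  obtain ⟨m, hm⟩ := hne
  refine hm (h.visits_eq hk.symm hle ?_ m)
  rcases h.target with h10 | h10
  · rw [← h10, hv, h.up]
  · have h11 := numUp_sub_numDown_visits σ n c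
    have h12 := h.bal c
    rw [← h10, hv, h.down, ← hk] at h11
    rw [← h10] at h12
    omega

lemma visits_le_of_le_sum (h : IsFlow σ c e a b) (s : Finset ℤ)
    (hs : ∀ k, k ∉ s → a k + b k = 0) (n : ℕ) (hn : n ≤ ∑ k ∈ s, (a k + b k)) :
    (∀ k, visits σ n k ≤ a k + b k) ∧ ∑ k ∈ s, visits σ n k = n := by
  induction n with
  | zero => simp
  | succ n ih =>
    obtain ⟨h1, h2⟩ := ih (by omega)
    have h3 : ∀ k, visits σ (n + 1) k ≤ a k + b k := by
      refine h.visits_succ_le h1 ?_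
      by_contra! h4
      rw [Finset.sum_congr rfl fun k _ => h4 k] at h2
      omega
    refine ⟨h3, ?_⟩
    have h4 : walkPos σ n ∈ s := by
      by_contra h5
      have h6 := h3 (walkPos σ n)
      rw [hs _ h5, visits_succ, if_pos rfl] at h6
      omega
    simp only [visits_succ, Finset.sum_add_distrib, h2]
    simp [h4]

lemma visits_sum (h : IsFlow σ c e a b) (s : Finset ℤ)
    (hs : ∀ k, k ∉ s → a k + b k = 0) (k : ℤ) :
    visits σ (∑ k ∈ s, (a k + b k)) k = a k + b k := by
  obtain ⟨h1, h2⟩ := h.visits_le_of_le_sum s hs _ le_rfl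
  by_cases hk : k ∈ s
  · exact (Finset.sum_eq_sum_iff_of_le fun i _ => h1 i).1 h2 k hk
  · have := h1 k
    rw [hs k hk] at this ⊢
    omega

lemma eq_sum (h : IsFlow σ c e a b) (s : Finset ℤ)
    (hs : ∀ k, k ∉ s → a k + b k = 0) {n : ℕ} (hn : n ≤ ∑ k ∈ s, (a k + b k))
    (he : walkPos σ n = e) (hc : numUp (σ c) (visits σ n c) = a c) :
    n = ∑ k ∈ s, (a k + b k) := by
  obtain ⟨h1, h2⟩ := h.visits_le_of_le_sum s hs _ hn
  rw [← h2]
  exact Finset.sum_congr rfl fun k _ => h.visits_eq he h1 hc k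

lemma Tp_eq (h : IsFlow σ c (c + 1) a b) (s : Finset ℤ)
    (hs : ∀ k, k ∉ s → a k + b k = 0) (ha : 0 < a c) :
    Tp (walkPos σ) c (a c) = ∑ k ∈ s, (a k + b k) := by
  have hmem : (∑ k ∈ s, (a k + b k)) ∈ {n | a c ≤ dirLocP (walkPos σ) n c} := by
    rw [Set.mem_ofPred_eq, dirLocP_walkPos, h.visits_sum s hs, h.up]
  have h1 : Tp (walkPos σ) c (a c) ≤ ∑ k ∈ s, (a k + b k) := Nat.sInf_le hmem
  have h2 : a c ≤ dirLocP (walkPos σ) (Tp (walkPos σ) c (a c)) c := Nat.sInf_mem ⟨_, hmem⟩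
  have h3 : ∀ n < Tp (walkPos σ) c (a c), dirLocP (walkPos σ) n c < a c := fun n hn => by
    simpa using Nat.notMem_of_lt_sInf hn
  generalize Tp (walkPos σ) c (a c) = T at *
  refine h.eq_sum s hs h1 ?_ ?_
  · obtain - | T := T
    · simp [dirLocP] at h2; omega
    · have h4 := h3 T (by omega)
      rw [dirLocP_succ] at h2
      split_ifs at h2 with h5
      · exact h5.2
      · omega
  · refine le_antisymm ?_ (by rwa [← dirLocP_walkPos])
    have := numUp_mono (σ c) ((h.visits_le_of_le_sum s hs _ h1).1 c)
    rwa [h.up] at this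

lemma Tm_eq (h : IsFlow σ c c a b) (s : Finset ℤ)
    (hs : ∀ k, k ∉ s → a k + b k = 0) (hb : 0 < b (c + 1)) :
    Tm (walkPos σ) (c + 1) (b (c + 1)) = ∑ k ∈ s, (a k + b k) := by
  have hmem : (∑ k ∈ s, (a k + b k)) ∈
      {n | b (c + 1) ≤ dirLocM (walkPos σ) n (c + 1)} := by
    rw [Set.mem_ofPred_eq, dirLocM_walkPos, h.visits_sum s hs, h.down]
  have h1 : Tm (walkPos σ) (c + 1) (b (c + 1)) ≤ ∑ k ∈ s, (a k + b k) := Nat.sInf_le hmem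
  have h2 : b (c + 1) ≤ dirLocM (walkPos σ) (Tm (walkPos σ) (c + 1) (b (c + 1))) (c + 1) :=
    Nat.sInf_mem ⟨_, hmem⟩
  have h3 : ∀ n < Tm (walkPos σ) (c + 1) (b (c + 1)),
      dirLocM (walkPos σ) n (c + 1) < b (c + 1) := fun n hn => by
    simpa using Nat.notMem_of_lt_sInf hn
  generalize Tm (walkPos σ) (c + 1) (b (c + 1)) = T at *
  have h6 : walkPos σ T = c := by
    obtain - | T := T
    · simp [dirLocM] at h2; omega
    · have h4 := h3 T (by omega)
      rw [dirLocM_succ] at h2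
      split_ifs at h2 with h5
      · rw [h5.2]; ring
      · omega
  refine h.eq_sum s hs h1 h6 ?_
  have h7 : numDown (σ (c + 1)) (visits σ T (c + 1)) = b (c + 1) := by
    refine le_antisymm ?_ (by rwa [← dirLocM_walkPos])
    have := numDown_mono (σ (c + 1)) ((h.visits_le_of_le_sum s hs _ h1).1 (c + 1))
    rwa [h.down] at this
  have h8 := numUp_sub_numDown_visits σ T c
  have h9 := h.bal c
  rw [h6] at h8
  omega

end IsFlow

lemma profile_eq_zero_of_le (σ : ℕ → ℕ → Bool) {R N i j : ℕ} (hN : N ≤ i) (hij : i ≤ j)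
    (h : profile σ R N i = 0) : profile σ R N j = 0 := by
  induction j, hij using Nat.le_induction with
  | base => exact h
  | succ j hj ih =>
    have e : profile σ R N (j + 1) =
      upsBefore (σ j) (profile σ R N j) + if j < N then 1 else 0 := rfl
    rw [e, ih, upsBefore_zero, if_neg (by omega)]

lemma sum_profile_add_upsBefore (σ : ℕ → ℕ → Bool) {R N K : ℕ} (hN : N ≤ K)
    (h : profile σ R N K = 0) :
    ∑ i ∈ Finset.range K, (profile σ R N i + upsBefore (σ i) (profile σ R N i)) + R + N =
      2 * ∑ i ∈ Finset.range K, profile σ R N i := by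
  have key : ∀ K : ℕ, ∑ i ∈ Finset.range K, (profile σ R N i + upsBefore (σ i) (profile σ R N i)) +
      R + min K N = 2 * ∑ i ∈ Finset.range K, profile σ R N i + profile σ R N K := by
    intro K
    induction K with
    | zero =>
      have e : profile σ R N 0 = R := rfl
      simp [e]
    | succ K ih =>
      have e : profile σ R N (K + 1) =
        upsBefore (σ K) (profile σ R N K) + if K < N then 1 else 0 := rfl
      rw [Finset.sum_range_succ, Finset.sum_range_succ, e]
      split_ifs <;> omega
  have := key K
  rw [h, min_eq_right hN] at this
  omega

/-- The stacks to the left of `c + 1`, read from right to left with directions reversed. -/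
def leftStacks (σ : ℤ → ℕ → Bool) (c : ℤ) (i : ℕ) : ℕ → Bool := flipStack (σ (c - i))

/-- The stacks to the right of `c`. -/
def rightStacks (σ : ℤ → ℕ → Bool) (c : ℤ) (i : ℕ) : ℕ → Bool := σ (c + 1 + i)

lemma numUp_add_upsBefore_flipStack {s : ℕ → Bool} (hs : HasDowns (flipStack s)) (m : ℕ) :
    numUp s (m + upsBefore (flipStack s) m) = m := by
  have h1 := numUp_upsBefore hs m
  have h2 := numUp_add_numDown (flipStack s) (upsBefore (flipStack s) m + m)
  rw [h1, numDown_flipStack] at h2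
  rw [add_comm m]
  omega

lemma exists_isFlow (σ : ℤ → ℕ → Bool) (c e : ℤ) (he : e = c ∨ e = c + 1)
    (h1 : ∀ k, HasDowns (σ k)) (h2 : ∀ k, HasDowns (flipStack (σ k))) (l r : ℕ)
    (hlr : (l : ℤ) - r = netFlow e c) (K K' : ℕ) (hK1 : c.toNat ≤ K) (hK2 : (-c - 1).toNat ≤ K')
    (hl : profile (leftStacks σ c) l c.toNat K = 0)
    (hr : profile (rightStacks σ c) r (-c - 1).toNat K' = 0) :
    ∃ (a b : ℤ → ℕ) (s : Finset ℤ), IsFlow σ c e a b ∧ a c = l ∧ b (c + 1) = r ∧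
      (∀ k, k ∉ s → a k + b k = 0) ∧
      ∑ k ∈ s, (a k + b k) + l + r + c.toNat + (-c - 1).toNat =
        2 * ∑ i ∈ Finset.range K, profile (leftStacks σ c) l c.toNat i +
        2 * ∑ i ∈ Finset.range K', profile (rightStacks σ c) r (-c - 1).toNat i := by
  set L := profile (leftStacks σ c) l c.toNat with hL
  set R := profile (rightStacks σ c) r (-c - 1).toNat with hR
  have L0 : L 0 = l := rfl
  have R0 : R 0 = r := rfl
  have Ls : ∀ i, L (i + 1) = upsBefore (flipStack (σ (c - i))) (L i) +
    if i < c.toNat then 1 else 0 := fun i => rfl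
  have Rs : ∀ i, R (i + 1) = upsBefore (σ (c + 1 + i)) (R i) +
    if i < (-c - 1).toNat then 1 else 0 := fun i => rfl
  set a : ℤ → ℕ := fun k => if k ≤ c then L (c - k).toNat else
    upsBefore (σ k) (R (k - (c + 1)).toNat) with ha
  set b : ℤ → ℕ := fun k => if k ≤ c then upsBefore (flipStack (σ k)) (L (c - k).toNat) else
    R (k - (c + 1)).toNat with hb
  have al : ∀ i : ℕ, a (c - i) = L i := fun i => by
    simp only [ha]
    rw [if_pos (by omega), show (c - (c - (i : ℤ))).toNat = i by omega]
  have bl : ∀ i : ℕ, b (c - i) = upsBefore (flipStack (σ (c - i))) (L i) := fun i => by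
    simp only [hb]
    rw [if_pos (by omega), show (c - (c - (i : ℤ))).toNat = i by omega]
  have ar : ∀ i : ℕ, a (c + 1 + i) = upsBefore (σ (c + 1 + i)) (R i) := fun i => by
    simp only [ha]
    rw [if_neg (by omega), show (c + 1 + (i : ℤ) - (c + 1)).toNat = i by omega]
  have br : ∀ i : ℕ, b (c + 1 + i) = R i := fun i => by
    simp only [hb]
    rw [if_neg (by omega), show (c + 1 + (i : ℤ) - (c + 1)).toNat = i by omega]
  have site_cases : ∀ P : ℤ → Prop, (∀ i : ℕ, P (c - i)) → (∀ i : ℕ, P (c + 1 + i)) → ∀ k, P k := by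
    intro P p1 p2 k
    rcases le_or_gt k c with hk | hk
    · have := p1 (c - k).toNat
      rwa [show c - ((c - k).toNat : ℤ) = k by omega] at this
    · have := p2 (k - (c + 1)).toNat
      rwa [show c + 1 + ((k - (c + 1)).toNat : ℤ) = k by omega] at this
  have ac : a c = l := by simpa [L0] using al 0
  have bc : b (c + 1) = r := by simpa [R0] using br 0
  set s : Finset ℤ := (Finset.range K).image (fun i : ℕ => c - (i : ℤ)) ∪
    (Finset.range K').image (fun i : ℕ => c + 1 + (i : ℤ)) with hs
  refine ⟨a, b, s, ⟨?_, ?_, ?_, ?_, he⟩, ac, bc, ?_, ?_⟩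
  · refine site_cases _ (fun i => ?_) (fun i => ?_)
    · rw [al, bl]; exact numUp_add_upsBefore_flipStack (h2 _) _
    · rw [ar, br]; exact numUp_upsBefore (h1 _) _
  · refine site_cases _ (fun i => ?_) (fun i => ?_)
    · obtain - | i := i
      · simpa [ac, bc] using hlr
      · have e1 : c - ((i + 1 : ℕ) : ℤ) + 1 = c - i := by push_cast; ring
        rw [e1, al, bl, Ls]
        unfold netFlow
        push_cast
        split_ifs <;> omega
    · have e1 : c + 1 + (i : ℤ) + 1 = c + 1 + (i + 1 : ℕ) := by push_cast; ring
      rw [e1, ar, br, Rs]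
      unfold netFlow
      push_cast
      split_ifs <;> omega
  · intro k hk m hm
    have := site_cases (fun k => k ≤ c → ∀ m < a k + b k, numUp (σ k) m < a k) (fun i _ m hm => ?_)
      (fun i hi => by omega) k hk m hm
    · exact this
    · rw [al, bl] at hm
      rw [al, ← numDown_flipStack]
      exact numDown_lt_of_lt (h2 _) _ _ (by omega)
  · intro k hk m hm
    have := site_cases (fun k => c < k → ∀ m < a k + b k, numDown (σ k) m < b k)
      (fun i hi => by omega) (fun i _ m hm => ?_) k hk m hm
    · exact this
    · rw [ar, br] at hm
      rw [br]
      exact numDown_lt_of_lt (h1 _) _ _ hm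
  · refine site_cases _ (fun i hi => ?_) (fun i hi => ?_)
    · have hKi : K ≤ i := by
        by_contra! h
        exact hi (Finset.mem_union_left _ (Finset.mem_image_of_mem _ (Finset.mem_range.2 h)))
      have : L i = 0 := profile_eq_zero_of_le _ hK1 hKi hl
      rw [al, bl, this, upsBefore_zero]
    · have hKi : K' ≤ i := by
        by_contra! h
        exact hi (Finset.mem_union_right _ (Finset.mem_image_of_mem (fun i : ℕ => c + 1 + (i : ℤ))
          (Finset.mem_range.2 h)))
      have : R i = 0 := profile_eq_zero_of_le _ hK2 hKi hr
      rw [ar, br, this, upsBefore_zero]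
  · have hd : Disjoint ((Finset.range K).image (fun i : ℕ => c - (i : ℤ)))
        ((Finset.range K').image (fun i : ℕ => c + 1 + (i : ℤ))) := by
      rw [Finset.disjoint_left]
      intro k h3 h4
      simp only [Finset.mem_image] at h3 h4
      obtain ⟨i, -, rfl⟩ := h3
      obtain ⟨i', -, h4⟩ := h4
      omega
    rw [hs, Finset.sum_union hd, Finset.sum_image (fun i _ i' _ h => by simpa using h),
      Finset.sum_image (fun i _ i' _ h => by simpa using h)]
    have s1 := sum_profile_add_upsBefore (leftStacks σ c) hK1 hl
    have s2 := sum_profile_add_upsBefore (rightStacks σ c) hK2 hr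
    have s3 : ∑ i ∈ Finset.range K, (a (c - i) + b (c - i)) =
        ∑ i ∈ Finset.range K, (L i + upsBefore (leftStacks σ c i) (L i)) :=
      Finset.sum_congr rfl fun i _ => by rw [al, bl]; rfl
    have s4 : ∑ i ∈ Finset.range K', (a (c + 1 + i) + b (c + 1 + i)) =
        ∑ i ∈ Finset.range K', (R i + upsBefore (rightStacks σ c i) (R i)) :=
      Finset.sum_congr rfl fun i _ => by rw [ar, br, add_comm]; rfl
    rw [s3, s4]
    rw [← hL] at s1
    rw [← hR] at s2
    omega

lemma Tp_walkPos (σ : ℤ → ℕ → Bool) (j : ℤ) (h1 : ∀ k, HasDowns (σ k))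
    (h2 : ∀ k, HasDowns (flipStack (σ k))) (r : ℕ) (hr : 1 ≤ r) (K K' : ℕ)
    (hK1 : j.toNat ≤ K) (hK2 : (-j - 1).toNat ≤ K') (h3 : profile (leftStacks σ j) r j.toNat K = 0)
    (h4 : profile (rightStacks σ j) (r - if 0 ≤ j then 1 else 0) (-j - 1).toNat K' = 0) :
    Tp (walkPos σ) j r + r + (r - if 0 ≤ j then 1 else 0) + j.toNat + (-j - 1).toNat =
      2 * ∑ i ∈ Finset.range K, profile (leftStacks σ j) r j.toNat i +
      2 * ∑ i ∈ Finset.range K',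
        profile (rightStacks σ j) (r - if 0 ≤ j then 1 else 0) (-j - 1).toNat i := by
  obtain ⟨a, b, s, hf, rfl, -, hs, hsum⟩ := exists_isFlow σ j (j + 1) (Or.inr rfl) h1 h2 r _
    (by unfold netFlow; split_ifs <;> omega) K K' hK1 hK2 h3 h4
  rw [hf.Tp_eq s hs hr, hsum]

lemma Tm_walkPos (σ : ℤ → ℕ → Bool) (j : ℤ) (h1 : ∀ k, HasDowns (σ k))
    (h2 : ∀ k, HasDowns (flipStack (σ k))) (r : ℕ) (hr : 1 ≤ r) (K K' : ℕ)
    (hK1 : (j - 1).toNat ≤ K) (hK2 : (-(j - 1) - 1).toNat ≤ K')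
    (h3 : profile (leftStacks σ (j - 1)) (r - if j - 1 < 0 then 1 else 0) (j - 1).toNat K = 0)
    (h4 : profile (rightStacks σ (j - 1)) r (-(j - 1) - 1).toNat K' = 0) :
    Tm (walkPos σ) j r + (r - if j - 1 < 0 then 1 else 0) + r + (j - 1).toNat +
        (-(j - 1) - 1).toNat =
      2 * ∑ i ∈ Finset.range K,
        profile (leftStacks σ (j - 1)) (r - if j - 1 < 0 then 1 else 0) (j - 1).toNat i +
      2 * ∑ i ∈ Finset.range K', profile (rightStacks σ (j - 1)) r (-(j - 1) - 1).toNat i := by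
  obtain ⟨a, b, s, hf, -, rfl, hs, hsum⟩ := exists_isFlow σ (j - 1) (j - 1) (Or.inl rfl) h1 h2 _ r
    (by unfold netFlow; split_ifs <;> omega) K K' hK1 hK2 h3 h4
  have := hf.Tm_eq s hs hr
  rw [sub_add_cancel] at this
  rw [← hsum, sub_add_cancel, this]

lemma IsSRW.measure_zero_eq {w : ℤ → ℝ} {Ω : Type*} [MeasurableSpace Ω] {μ : Measure Ω}
    [IsProbabilityMeasure μ] {X : ℕ → Ω → ℤ} (hX : IsSRW μ w X) {z : ℤ} (hz : z ≠ 0) :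
    μ {ω | X 0 ω = z} = 0 := by
  have h1 : μ {ω | X 0 ω = 0}ᶜ = 0 :=
    (prob_compl_eq_zero_iff ((hX.1 0) (measurableSet_singleton 0))).2 hX.2.1
  refine measure_mono_null (fun ω hω => ?_) h1
  simp only [Set.mem_ofPred_eq, Set.mem_compl_iff] at hω ⊢
  rwa [hω]

lemma IsSRW.measure_cyl_eq {w : ℤ → ℝ} {Ω Ω' : Type*} [MeasurableSpace Ω] [MeasurableSpace Ω']
    {μ : Measure Ω} {ν : Measure Ω'} [IsProbabilityMeasure μ] [IsProbabilityMeasure ν]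
    {X : ℕ → Ω → ℤ} {Y : ℕ → Ω' → ℤ} (hX : IsSRW μ w X) (hY : IsSRW ν w Y) (n : ℕ) (x : ℕ → ℤ) :
    μ {ω | ∀ i ≤ n, X i ω = x i} = ν {ω | ∀ i ≤ n, Y i ω = x i} := by
  induction n with
  | zero =>
    simp only [Nat.le_zero, forall_eq]
    by_cases h : x 0 = 0
    · rw [h, hX.2.1, hY.2.1]
    · rw [hX.measure_zero_eq h, hY.measure_zero_eq h]
  | succ n ih => rw [hX.2.2, hY.2.2, ih]

lemma IsSRW.map_eq {w : ℤ → ℝ} {Ω Ω' : Type*} [MeasurableSpace Ω] [MeasurableSpace Ω']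
    {μ : Measure Ω} {ν : Measure Ω'} [IsProbabilityMeasure μ] [IsProbabilityMeasure ν]
    {X : ℕ → Ω → ℤ} {Y : ℕ → Ω' → ℤ} (hX : IsSRW μ w X) (hY : IsSRW ν w Y) :
    μ.map (fun ω n => X n ω) = ν.map (fun ω n => Y n ω) := by
  have mX : Measurable fun ω n => X n ω := measurable_pi_lambda _ hX.1
  have mY : Measurable fun ω n => Y n ω := measurable_pi_lambda _ hY.1
  have := Measure.isProbabilityMeasure_map (μ := μ) mX.aemeasurable
  have := Measure.isProbabilityMeasure_map (μ := ν) mY.aemeasurable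
  refine IsProjectiveLimit.unique (P := fun I : Finset ℕ => (ν.map (fun ω n => Y n ω)).map (I.restrict (π := fun _ => ℤ)))
    (fun I => ?_) (fun I => rfl)
  obtain ⟨n, hn⟩ : ∃ n, I ⊆ Finset.Iic n :=
    ⟨I.sup id, fun i hi => Finset.mem_Iic.2 (Finset.le_sup (f := id) hi)⟩
  have h1 : (μ.map (fun ω n => X n ω)).map ((Finset.Iic n).restrict (π := fun _ => ℤ)) =
      (ν.map (fun ω n => Y n ω)).map ((Finset.Iic n).restrict (π := fun _ => ℤ)) := by
    refine Measure.ext_of_singleton fun a => ?_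
    have key : ((Finset.Iic n).restrict (π := fun _ => ℤ)) ⁻¹' {a} =
        {p : ℕ → ℤ | ∀ i ≤ n, p i = if h : i ≤ n then a ⟨i, Finset.mem_Iic.2 h⟩ else 0} := by
      ext p
      simp only [Set.mem_preimage, Set.mem_singleton_iff, Set.mem_ofPred_eq, funext_iff]
      constructor
      · intro h i hi
        rw [dif_pos hi, ← h]; rfl
      · rintro h ⟨i, hi⟩
        have hi' := Finset.mem_Iic.1 hi
        have := h i hi'
        rwa [dif_pos hi'] at this
    have hm : MeasurableSet (((Finset.Iic n).restrict (π := fun _ => ℤ)) ⁻¹' {a} : Set (ℕ → ℤ)) :=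
      (Finset.measurable_restrict _) (measurableSet_singleton a)
    rw [Measure.map_apply (Finset.measurable_restrict _) (measurableSet_singleton a),
      Measure.map_apply (Finset.measurable_restrict _) (measurableSet_singleton a),
      Measure.map_apply mX hm, Measure.map_apply mY hm, key]
    exact hX.measure_cyl_eq hY n _
  have h2 : ∀ ρ : Measure (ℕ → ℤ), ρ.map (I.restrict (π := fun _ => ℤ)) =
      (ρ.map ((Finset.Iic n).restrict (π := fun _ => ℤ))).map (Finset.restrict₂ (π := fun _ => ℤ) hn) := fun ρ => by
    rw [Measure.map_map (Finset.measurable_restrict₂ _) (Finset.measurable_restrict _)]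
    rfl
  rw [h2, h1, ← h2]

/-- The independent stacks driving the walk of weight `w`. -/
def stacksLaw (w : ℤ → ℝ) : Measure (ℤ → ℕ → Bool) := Measure.infinitePi fun _ => stackLaw w

instance (w : ℤ → ℝ) : IsProbabilityMeasure (stacksLaw w) := by
  unfold stacksLaw; infer_instance

lemma stacksLaw_map_eval (w : ℤ → ℝ) (k : ℤ) :
    (stacksLaw w).map (fun σ => σ k) = stackLaw w := Measure.infinitePi_map_eval _ k

lemma iIndepFun_stacksLaw (w : ℤ → ℝ) :
    ProbabilityTheory.iIndepFun (fun (k : ℤ) (σ : ℤ → ℕ → Bool) => σ k) (stacksLaw w) :=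
  ProbabilityTheory.iIndepFun_infinitePi (X := fun (_ : ℤ) (s : ℕ → Bool) => s)
    (fun _ => measurable_id)

lemma isStackSeq_rightStacks {w : ℤ → ℝ} (hw : ∀ z, 0 < w z) (c : ℤ) :
    IsStackSeq w (stacksLaw w) (fun i σ => rightStacks σ c i) where
  meas i := measurable_pi_apply _
  indep := (iIndepFun_stacksLaw w).precomp (g := fun i : ℕ => c + 1 + (i : ℤ))
    (fun i j h => by simpa using h)
  law i := by
    have := stacksLaw_map_eval w (c + 1 + i)
    unfold rightStacks
    rw [this]
    exact isStackLaw_stackLaw hw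

lemma isStackSeq_leftStacks {w : ℤ → ℝ} (hw : ∀ z, 0 < w z) (c : ℤ) :
    IsStackSeq w (stacksLaw w) (fun i σ => leftStacks σ c i) where
  meas i := measurable_flipStack.comp (measurable_pi_apply _)
  indep := ((iIndepFun_stacksLaw w).precomp (g := fun i : ℕ => c - (i : ℤ))
    (fun i j h => by simpa using h)).comp (fun _ => flipStack) (fun _ => measurable_flipStack)
  law i := by
    have h1 : (stacksLaw w).map (fun σ => leftStacks σ c i) =
        (stackLaw w).map flipStack := by
      rw [← stacksLaw_map_eval w (c - i),
        Measure.map_map measurable_flipStack (measurable_pi_apply _)]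
      rfl
    rw [h1]
    exact (isStackLaw_stackLaw hw).map_flipStack

lemma ae_hasDowns_stacksLaw {w : ℤ → ℝ} (hw : GoodWeight w) : ∀ᵐ σ ∂stacksLaw w,
    ∀ k, HasDowns (σ k) ∧ HasDowns (flipStack (σ k)) := by
  rw [ae_all_iff]
  intro k
  have h1 := (isStackLaw_stackLaw hw.1).ae_hasDowns hw
  have := Measure.isProbabilityMeasure_map (μ := stackLaw w) measurable_flipStack.aemeasurable
  have h2 := (isStackLaw_stackLaw hw.1).map_flipStack.ae_hasDowns hw
  have h3 := ae_of_ae_map measurable_flipStack.aemeasurable h2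
  have h4 : ∀ᵐ s ∂(stacksLaw w).map (fun σ => σ k), HasDowns s ∧ HasDowns (flipStack s) := by
    rw [stacksLaw_map_eval]
    exact h1.and h3
  exact ae_of_ae_map (measurable_pi_apply k).aemeasurable h4

lemma measurable_walkPos_visits (n : ℕ) : Measurable (fun σ => walkPos σ n) ∧
    ∀ k, Measurable fun σ => visits σ n k := by
  induction n with
  | zero => exact ⟨measurable_const, fun k => measurable_const⟩
  | succ n ih =>
    obtain ⟨h1, h2⟩ := ih
    have h3 : Measurable fun σ => visits σ n (walkPos σ n) :=
      (measurable_from_prod_countable_left (f := fun p : (ℤ → ℕ → Bool) × ℤ => visits p.1 n p.2)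
        h2).comp (measurable_id.prodMk h1)
    have h4 : Measurable fun σ : ℤ → ℕ → Bool => σ (walkPos σ n) (visits σ n (walkPos σ n)) :=
      (measurable_from_prod_countable_left
        (f := fun p : (ℤ → ℕ → Bool) × (ℤ × ℕ) => p.1 p.2.1 p.2.2)
        (fun q => (measurable_pi_apply q.2).comp (measurable_pi_apply q.1))).comp
        (measurable_id.prodMk (h1.prodMk h3))
    constructor
    · simp_rw [walkPos_succ]
      exact Measurable.ite (h4 (measurableSet_singleton true))
        (h1.add_const 1) (h1.sub_const 1)
    · intro k
      simp_rw [visits_succ]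
      exact (h2 k).add (Measurable.ite (measurableSet_eq_fun measurable_const h1)
        measurable_const measurable_const)

/-- The directions of the departures of the path `x` from `k` before time `n`. -/
def pathWord (x : ℕ → ℤ) : ℕ → ℤ → List Bool
  | 0, _ => []
  | n + 1, k => pathWord x n k ++ if x n = k then [decide (x (n + 1) = k + 1)] else []

lemma pathWord_succ (x : ℕ → ℤ) (n : ℕ) (k : ℤ) : pathWord x (n + 1) k =
    pathWord x n k ++ if x n = k then [decide (x (n + 1) = k + 1)] else [] := rfl

lemma length_pathWord {σ : ℤ → ℕ → Bool} {x : ℕ → ℤ} {n : ℕ} (h : ∀ i < n, walkPos σ i = x i)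
    (k : ℤ) : (pathWord x n k).length = visits σ n k := by
  induction n with
  | zero => rfl
  | succ n ih =>
    rw [pathWord_succ, visits_succ, List.length_append, ih fun i hi => h i (by omega),
      h n (by omega)]
    by_cases hk : x n = k
    · simp [hk]
    · simp [hk, Ne.symm hk]

lemma excess_pathWord {x : ℕ → ℤ} {n : ℕ}
    (h : ∀ i < n, x (i + 1) = x i + 1 ∨ x (i + 1) = x i - 1) (k : ℤ) :
    excess (pathWord x n k) = (dirLocP x n k : ℤ) - dirLocM x n k := by
  induction n with
  | zero => simp [pathWord, excess, dirLocP, dirLocM]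
  | succ n ih =>
    have ih := ih fun i hi => h i (by omega)
    have h1 := h n (by omega)
    rw [dirLocP_succ, dirLocM_succ, pathWord_succ]
    unfold excess at ih ⊢
    rw [List.count_append, List.count_append]
    by_cases hk : x n = k
    · rw [hk] at h1
      rcases h1 with h1 | h1
      · have : ¬ (k + 1 = k - 1) := by omega
        simp [hk, h1, this]
        omega
      · have : ¬ (k - 1 = k + 1) := by omega
        simp [hk, h1, this]
        omega
    · simp [hk, ih]

lemma walkPos_eq_iff (σ : ℤ → ℕ → Bool) {x : ℕ → ℤ} {n : ℕ} (h0 : x 0 = 0)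
    (h : ∀ i < n, x (i + 1) = x i + 1 ∨ x (i + 1) = x i - 1) :
    (∀ i ≤ n, walkPos σ i = x i) ↔ ∀ k, σ k ∈ stackCyl (pathWord x n k) := by
  induction n with
  | zero => simp [h0, pathWord, stackCyl]
  | succ n ih =>
    have ih := ih fun i hi => h i (by omega)
    have h1 := h n (by omega)
    have e1 : (∀ i ≤ n + 1, walkPos σ i = x i) ↔
        (∀ i ≤ n, walkPos σ i = x i) ∧ walkPos σ (n + 1) = x (n + 1) := by
      constructor
      · intro h; exact ⟨fun i hi => h i (by omega), h _ le_rfl⟩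
      · rintro ⟨h2, h3⟩ i hi
        rcases Nat.lt_or_ge n i with h4 | h4
        · rw [show i = n + 1 by omega, h3]
        · exact h2 i h4
    have e2 : (∀ k, σ k ∈ stackCyl (pathWord x (n + 1) k)) ↔
        (∀ k, σ k ∈ stackCyl (pathWord x n k)) ∧
          σ (x n) (pathWord x n (x n)).length = decide (x (n + 1) = x n + 1) := by
      constructor
      · intro h
        have h3 := h (x n)
        rw [pathWord_succ, if_pos rfl, mem_stackCyl_append] at h3
        refine ⟨fun k => ?_, h3.2⟩
        by_cases hk : x n = k
        · rw [← hk]; exact h3.1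
        · have := h k
          rwa [pathWord_succ, if_neg hk, List.append_nil] at this
      · rintro ⟨h2, h3⟩ k
        rw [pathWord_succ]
        by_cases hk : x n = k
        · subst hk
          rw [if_pos rfl, mem_stackCyl_append]
          exact ⟨h2 _, h3⟩
        · rw [if_neg hk, List.append_nil]; exact h2 k
    rw [e1, e2, ← ih]
    refine and_congr_right fun h2 => ?_
    rw [length_pathWord (fun i hi => h2 i hi.le), walkPos_succ, h2 n le_rfl]
    rcases h1 with h1 | h1 <;> rw [h1]
    · cases σ (x n) (visits σ n (x n)) <;> simp
      omega
    · have : ¬ (x n - 1 = x n + 1) := by omega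
      cases σ (x n) (visits σ n (x n)) <;> simp [this]
      omega

lemma measure_walkPos_eq (w : ℤ → ℝ) {x : ℕ → ℤ} {n : ℕ} (h0 : x 0 = 0)
    (h : ∀ i < n, x (i + 1) = x i + 1 ∨ x (i + 1) = x i - 1) (s : Finset ℤ)
    (hs : ∀ i < n, x i ∈ s) :
    stacksLaw w {σ | ∀ i ≤ n, walkPos σ i = x i} =
      ∏ k ∈ s, stackLaw w (stackCyl (pathWord x n k)) := by
  have h1 : ∀ k, k ∉ s → pathWord x n k = [] := by
    intro k hk
    clear h
    induction n with
    | zero => rfl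
    | succ n ih =>
      rw [pathWord_succ, ih fun i hi => hs i (by omega), if_neg, List.append_nil]
      rintro rfl
      exact hk (hs n (by omega))
  rw [stacksLaw, ← Measure.infinitePi_pi (μ := fun _ : ℤ => stackLaw w)
    (t := fun k => stackCyl (pathWord x n k)) fun k _ => measurableSet_stackCyl _]
  congr 1
  ext σ
  simp only [Set.mem_ofPred_eq, walkPos_eq_iff σ h0 h, Set.mem_pi, Finset.mem_coe]
  refine ⟨fun h k _ => h k, fun h k => ?_⟩
  by_cases hk : k ∈ s
  · exact h k hk
  · rw [h1 k hk]; simp [stackCyl]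

lemma walkPos_step (σ : ℤ → ℕ → Bool) (n : ℕ) :
    walkPos σ (n + 1) = walkPos σ n + 1 ∨ walkPos σ (n + 1) = walkPos σ n - 1 := by
  rw [walkPos_succ]; split_ifs <;> simp

lemma isSRW_walkPos {w : ℤ → ℝ} (hw : ∀ z, 0 < w z) :
    IsSRW (stacksLaw w) w (fun n σ => walkPos σ n) := by
  refine ⟨fun n => (measurable_walkPos_visits n).1, by simp, fun n x => ?_⟩
  by_cases hv : x 0 = 0 ∧ ∀ i < n, x (i + 1) = x i + 1 ∨ x (i + 1) = x i - 1
  swap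
  · have e : ∀ m, n ≤ m → stacksLaw w {σ | ∀ i ≤ m, walkPos σ i = x i} = 0 := by
      intro m hm
      rw [Set.eq_empty_of_forall_notMem (s := {σ | ∀ i ≤ m, walkPos σ i = x i}), measure_empty]
      intro σ h
      simp only [Set.mem_ofPred_eq] at h
      refine hv ⟨by rw [← h 0 (by omega)]; rfl, fun i hi => ?_⟩
      rw [← h i (by omega), ← h (i + 1) (by omega)]
      exact walkPos_step σ i
    rw [e _ (by omega), e _ le_rfl, zero_mul]
  obtain ⟨h0, hn⟩ := hv
  by_cases hs : x (n + 1) = x n + 1 ∨ x (n + 1) = x n - 1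
  swap
  · have e : stacksLaw w {σ | ∀ i ≤ n + 1, walkPos σ i = x i} = 0 := by
      rw [Set.eq_empty_of_forall_notMem (s := {σ | ∀ i ≤ n + 1, walkPos σ i = x i}),
        measure_empty]
      intro σ h
      simp only [Set.mem_ofPred_eq] at h
      refine hs ?_
      rw [← h n (by omega), ← h (n + 1) (by omega)]
      exact walkPos_step σ n
    push Not at hs
    rw [e, stepProb, if_neg hs.1, if_neg hs.2, ENNReal.ofReal_zero, mul_zero]
  have hn' : ∀ i < n + 1, x (i + 1) = x i + 1 ∨ x (i + 1) = x i - 1 := by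
    intro i hi
    rcases Nat.lt_succ_iff_lt_or_eq.1 hi with h | rfl
    · exact hn i h
    · exact hs
  set s := (Finset.range (n + 1)).image x with hsdef
  have hxs : ∀ i < n + 1, x i ∈ s := fun i hi =>
    Finset.mem_image_of_mem x (Finset.mem_range.2 hi)
  rw [measure_walkPos_eq w h0 hn' s hxs, measure_walkPos_eq w h0 hn s fun i hi => hxs i (by omega),
    ← Finset.mul_prod_erase s _ (hxs n (by omega)), ← Finset.mul_prod_erase s _ (hxs n (by omega)),
    pathWord_succ, if_pos rfl, isStackLaw_stackLaw hw]
  have e1 : ∏ k ∈ s.erase (x n), stackLaw w (stackCyl (pathWord x (n + 1) k)) =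
      ∏ k ∈ s.erase (x n), stackLaw w (stackCyl (pathWord x n k)) :=
    Finset.prod_congr rfl fun k hk => by
      rw [pathWord_succ, if_neg (Finset.ne_of_mem_erase hk).symm, List.append_nil]
  have e2 : letterProb w (pathWord x n (x n)) (decide (x (n + 1) = x n + 1)) =
      stepProb w x n := by
    unfold letterProb stepProb upProb
    rw [excess_pathWord hn]
    rcases hs with h1 | h1
    · simp [h1]
    · have : ¬ (x n - 1 = x n + 1) := by omega
      simp [h1, this, add_comm]
  rw [e1, e2]
  ring

lemma tendsto_div_of_abs_sub_le {f : ℝ → ℝ} {C y : ℝ} (h : ∀ᶠ A in atTop, |f A - A * y| ≤ C) :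
    Tendsto (fun A => f A / A) atTop (𝓝 y) := by
  have h1 : Tendsto (fun A : ℝ => C / A) atTop (𝓝 0) := tendsto_const_nhds.div_atTop tendsto_id
  rw [tendsto_iff_norm_sub_tendsto_zero]
  refine squeeze_zero' (Eventually.of_forall fun A => norm_nonneg _) ?_ h1
  filter_upwards [h, eventually_gt_atTop 0] with A hA h0
  rw [Real.norm_eq_abs, show f A / A - y = (f A - A * y) / A by field_simp, abs_div,
    abs_of_pos h0]
  gcongr

lemma abs_toNat_sub_le {c : ℤ} {y A C : ℝ} (hA : 0 ≤ A) (h : |(c : ℝ) - A * y| ≤ C) :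
    |((c.toNat : ℕ) : ℝ) - A * max y 0| ≤ C := by
  have h1 : ((c.toNat : ℕ) : ℝ) = max (c : ℝ) 0 := by
    rw [← Int.cast_natCast, Int.toNat_eq_max]; push_cast; rfl
  have h2 : A * max y 0 = max (A * y) 0 := by
    rw [mul_max_of_nonneg _ _ hA, mul_zero]
  rw [h1, h2]
  exact (abs_max_sub_max_le_abs _ _ _).trans h

lemma tendsto_toNat_div {c : ℝ → ℤ} {y C : ℝ} (h : ∀ A, |(c A : ℝ) - A * y| ≤ C) :
    Tendsto (fun A => ((c A).toNat : ℝ) / A) atTop (𝓝 (max y 0)) := by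
  refine tendsto_div_of_abs_sub_le (C := C) ?_
  filter_upwards [eventually_ge_atTop 0] with A hA
  exact abs_toNat_sub_le hA (h A)

lemma abs_floor_add_sub_le (y : ℝ) (d : ℤ) : |((⌊y⌋ + d : ℤ) : ℝ) - y| ≤ 1 + |(d : ℝ)| := by
  have h1 := Int.floor_le y
  have h2 := Int.lt_floor_add_one y
  push_cast
  rw [abs_le]
  constructor
  · linarith [neg_abs_le (d : ℝ)]
  · linarith [le_abs_self (d : ℝ)]

/-- Weak law for a time expressed through the profiles started from `l A` and `r A` on both sides of
the edge `{c A, c A + 1}`. -/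
lemma tendsto_measure_of_profile {w : ℤ → ℝ} (hw : GoodWeight w) {c : ℝ → ℤ} {l r : ℝ → ℕ}
    {T : ℝ → (ℤ → ℕ → Bool) → ℕ} {x h : ℝ} (hh : 0 < h)
    (hc1 : Tendsto (fun A => ((c A).toNat : ℝ) / A) atTop (𝓝 (max x 0)))
    (hc2 : Tendsto (fun A => ((-c A - 1).toNat : ℝ) / A) atTop (𝓝 (max (-x) 0)))
    (hl : Tendsto (fun A => (l A : ℝ) / A) atTop (𝓝 h))
    (hr : Tendsto (fun A => (r A : ℝ) / A) atTop (𝓝 h))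
    (hT : ∀ᶠ A in atTop, ∀ σ, (∀ k, HasDowns (σ k)) → (∀ k, HasDowns (flipStack (σ k))) →
      ∀ K K', (c A).toNat ≤ K → (-c A - 1).toNat ≤ K' →
      profile (leftStacks σ (c A)) (l A) (c A).toNat K = 0 →
      profile (rightStacks σ (c A)) (r A) (-c A - 1).toNat K' = 0 →
      T A σ + l A + r A + (c A).toNat + (-c A - 1).toNat =
        2 * ∑ i ∈ Finset.range K, profile (leftStacks σ (c A)) (l A) (c A).toNat i +
        2 * ∑ i ∈ Finset.range K', profile (rightStacks σ (c A)) (r A) (-c A - 1).toNat i)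
    {ε : ℝ} (hε : 0 < ε) :
    Tendsto (fun A : ℝ => stacksLaw w {σ | ε < |(A ^ 2)⁻¹ * (T A σ : ℝ) - (|x| + 2 * h) ^ 2|})
      atTop (𝓝 0) := by
  rw [ENNReal.tendsto_nhds_zero]
  intro δ hδ
  obtain ⟨d, hd0, hdδ⟩ := ENNReal.lt_iff_exists_nnreal_btwn.1 hδ
  set η : ℝ := min (ε / 32) (d / 4) with hη
  have hd : (0 : ℝ) < d := by exact_mod_cast hd0
  have hη0 : 0 < η := lt_min (by linarith) (by linarith)
  have hM : 0 < h + |x| + 1 := by positivity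
  obtain ⟨n₀, hn₀⟩ := exists_profile_estimate hw hM hη0
  have hle : ∀ {f : ℝ → ℕ} {y : ℝ}, y < h + |x| + 1 →
      Tendsto (fun A => (f A : ℝ) / A) atTop (𝓝 y) →
      ∀ᶠ A : ℝ in atTop, (f A : ℝ) ≤ (h + |x| + 1) * ⌈A⌉₊ := by
    intro f y hy hf
    filter_upwards [hf.eventually_lt_const hy, eventually_gt_atTop 0] with A h1 h2
    rw [div_lt_iff₀ h2] at h1
    exact h1.le.trans (by gcongr; exact Nat.le_ceil A)
  have hD : Tendsto (fun A : ℝ =>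
      2 * (((l A : ℝ) / A) ^ 2 + 2 * ((l A : ℝ) / A) * (((c A).toNat : ℝ) / A) +
        (((c A).toNat : ℝ) / A) ^ 2 / 2) +
      2 * (((r A : ℝ) / A) ^ 2 + 2 * ((r A : ℝ) / A) * (((-c A - 1).toNat : ℝ) / A) +
        (((-c A - 1).toNat : ℝ) / A) ^ 2 / 2) -
      ((l A : ℝ) / A + (r A : ℝ) / A + ((c A).toNat : ℝ) / A + ((-c A - 1).toNat : ℝ) / A) / A)
      atTop (𝓝 ((|x| + 2 * h) ^ 2)) := by
    have h1 := ((((hl.pow 2).add ((hl.const_mul 2).mul hc1)).add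
      ((hc1.pow 2).div_const 2)).const_mul 2).add
      ((((hr.pow 2).add ((hr.const_mul 2).mul hc2)).add ((hc2.pow 2).div_const 2)).const_mul 2)
    have h2 := h1.sub ((((hl.add hr).add hc1).add hc2).div_atTop tendsto_id)
    have h3 : (|x| + 2 * h) ^ 2 = 2 * (h ^ 2 + 2 * h * max x 0 + max x 0 ^ 2 / 2) +
        2 * (h ^ 2 + 2 * h * max (-x) 0 + max (-x) 0 ^ 2 / 2) - 0 := by
      rcases le_total 0 x with hx | hx
      · rw [max_eq_left hx, max_eq_right (by linarith), abs_of_nonneg hx]; ring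
      · rw [max_eq_right hx, max_eq_left (by linarith), abs_of_nonpos hx]; ring
    rw [h3]
    exact h2
  have hDε := (tendsto_iff_norm_sub_tendsto_zero.1 hD).eventually_lt_const (half_pos hε)
  filter_upwards [hT, hle (by linarith [abs_nonneg x]) hl, hle (by linarith [abs_nonneg x]) hr,
    hle (max_lt (by linarith [le_abs_self x]) hM) hc1,
    hle (max_lt (by linarith [neg_le_abs x]) hM) hc2, hDε, eventually_ge_atTop 1,
    eventually_ge_atTop (n₀ : ℝ)] with A hT hl hr hc1 hc2 hDε hA1 hAn
  set n := ⌈A⌉₊ with hn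
  have hnn : n₀ ≤ n := by exact_mod_cast hAn.trans (Nat.le_ceil A)
  have hn2 : (n : ℝ) ≤ 2 * A := by
    have := Nat.ceil_lt_add_one (a := A) (by linarith)
    linarith
  obtain ⟨p1, p2⟩ := hn₀ n hnn (stacksLaw w) _ (isStackSeq_leftStacks hw.1 (c A)) (l A)
    (c A).toNat hl hc1
  obtain ⟨p3, p4⟩ := hn₀ n hnn (stacksLaw w) _ (isStackSeq_rightStacks hw.1 (c A)) (r A)
    (-c A - 1).toNat hr hc2
  set K := 2 * l A + 2 * (c A).toNat + n with hK
  set K' := 2 * r A + 2 * (-c A - 1).toNat + n with hK'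
  set N := (c A).toNat
  set N' := (-c A - 1).toNat
  set E1 : Set (ℤ → ℕ → Bool) := {σ | profile (fun j => leftStacks σ (c A) j) (l A) N K ≠ 0}
  set E2 : Set (ℤ → ℕ → Bool) := {σ | η * (n : ℝ) ^ 2 < |(∑ i ∈ Finset.range K,
    (profile (fun j => leftStacks σ (c A) j) (l A) N i : ℝ)) -
      ((l A : ℝ) ^ 2 + 2 * (l A : ℝ) * (N : ℝ) + (N : ℝ) ^ 2 / 2)|}
  set E3 : Set (ℤ → ℕ → Bool) := {σ | profile (fun j => rightStacks σ (c A) j) (r A) N' K' ≠ 0}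
  set E4 : Set (ℤ → ℕ → Bool) := {σ | η * (n : ℝ) ^ 2 < |(∑ i ∈ Finset.range K',
    (profile (fun j => rightStacks σ (c A) j) (r A) N' i : ℝ)) -
      ((r A : ℝ) ^ 2 + 2 * (r A : ℝ) * (N' : ℝ) + (N' : ℝ) ^ 2 / 2)|}
  set E5 : Set (ℤ → ℕ → Bool) := {σ | ∀ k, HasDowns (σ k) ∧ HasDowns (flipStack (σ k))}ᶜ
  have p5 : stacksLaw w E5 = 0 := ae_hasDowns_stacksLaw hw
  have hsub : {σ | ε < |(A ^ 2)⁻¹ * (T A σ : ℝ) - (|x| + 2 * h) ^ 2|} ⊆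
      ((E1 ∪ E2) ∪ (E3 ∪ E4)) ∪ E5 := by
    intro σ hσ
    by_contra hn
    simp only [Set.mem_union, not_or] at hn
    obtain ⟨⟨⟨q1, q2⟩, q3, q4⟩, q5⟩ := hn
    simp only [E1, E2, E3, E4, E5, Set.mem_ofPred_eq, not_not, not_lt, Set.mem_compl_iff]
      at q1 q2 q3 q4 q5 hσ
    have hTσ := hT σ (fun k => (q5 k).1) (fun k => (q5 k).2) K K' (by omega) (by omega) q1 q3
    have hTR : (T A σ : ℝ) + l A + r A + N + N' =
        2 * ∑ i ∈ Finset.range K, (profile (leftStacks σ (c A)) (l A) N i : ℝ) +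
        2 * ∑ i ∈ Finset.range K', (profile (rightStacks σ (c A)) (r A) N' i : ℝ) := by
      exact_mod_cast hTσ
    set SL := ∑ i ∈ Finset.range K, (profile (leftStacks σ (c A)) (l A) N i : ℝ)
    set SR := ∑ i ∈ Finset.range K', (profile (rightStacks σ (c A)) (r A) N' i : ℝ)
    have q2' : |SL - ((l A : ℝ) ^ 2 + 2 * (l A : ℝ) * (N : ℝ) + (N : ℝ) ^ 2 / 2)| ≤
      η * (n : ℝ) ^ 2 := q2
    have q4' : |SR - ((r A : ℝ) ^ 2 + 2 * (r A : ℝ) * (N' : ℝ) + (N' : ℝ) ^ 2 / 2)| ≤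
      η * (n : ℝ) ^ 2 := q4
    have hA0 : 0 < A := by linarith
    have hηn : η * (n : ℝ) ^ 2 ≤ ε / 8 * A ^ 2 := by
      calc η * (n : ℝ) ^ 2 ≤ ε / 32 * (2 * A) ^ 2 := by gcongr; exact min_le_left _ _
        _ = _ := by ring
    have e1 : (T A σ : ℝ) = A ^ 2 * (2 * (((l A : ℝ) / A) ^ 2 +
        2 * ((l A : ℝ) / A) * ((N : ℝ) / A) + ((N : ℝ) / A) ^ 2 / 2) +
      2 * (((r A : ℝ) / A) ^ 2 + 2 * ((r A : ℝ) / A) * ((N' : ℝ) / A) +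
        ((N' : ℝ) / A) ^ 2 / 2) -
      ((l A : ℝ) / A + (r A : ℝ) / A + (N : ℝ) / A + (N' : ℝ) / A) / A) +
      2 * (SL - ((l A : ℝ) ^ 2 + 2 * (l A : ℝ) * (N : ℝ) + (N : ℝ) ^ 2 / 2)) +
      2 * (SR - ((r A : ℝ) ^ 2 + 2 * (r A : ℝ) * (N' : ℝ) + (N' : ℝ) ^ 2 / 2)) := by
      have : (T A σ : ℝ) = 2 * SL + 2 * SR - (l A + r A + N + N') := by linarith
      rw [this]
      field_simp
      ring
    rw [Real.norm_eq_abs] at hDε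
    generalize 2 * (((l A : ℝ) / A) ^ 2 +
        2 * ((l A : ℝ) / A) * ((N : ℝ) / A) + ((N : ℝ) / A) ^ 2 / 2) +
      2 * (((r A : ℝ) / A) ^ 2 + 2 * ((r A : ℝ) / A) * ((N' : ℝ) / A) +
        ((N' : ℝ) / A) ^ 2 / 2) -
      ((l A : ℝ) / A + (r A : ℝ) / A + (N : ℝ) / A + (N' : ℝ) / A) / A = D at *
    generalize SL - ((l A : ℝ) ^ 2 + 2 * (l A : ℝ) * (N : ℝ) + (N : ℝ) ^ 2 / 2) = U at *
    generalize SR - ((r A : ℝ) ^ 2 + 2 * (r A : ℝ) * (N' : ℝ) + (N' : ℝ) ^ 2 / 2) = V at *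
    have e2 : (A ^ 2)⁻¹ * (T A σ : ℝ) - (|x| + 2 * h) ^ 2 =
        (D - (|x| + 2 * h) ^ 2) + (2 * U + 2 * V) / A ^ 2 := by
      rw [e1]; field_simp; ring
    have e3 : |(2 * U + 2 * V) / A ^ 2| ≤ ε / 2 := by
      rw [abs_div, abs_of_pos (by positivity : 0 < A ^ 2), div_le_iff₀ (by positivity)]
      rw [abs_le] at q2' q4' ⊢
      constructor <;> linarith [q2'.1, q2'.2, q4'.1, q4'.2]
    rw [e2] at hσ
    have e4 := abs_add_le (D - (|x| + 2 * h) ^ 2) ((2 * U + 2 * V) / A ^ 2)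
    linarith
  calc stacksLaw w {σ | ε < |(A ^ 2)⁻¹ * (T A σ : ℝ) - (|x| + 2 * h) ^ 2|}
      ≤ stacksLaw w (((E1 ∪ E2) ∪ (E3 ∪ E4)) ∪ E5) := measure_mono hsub
    _ ≤ ((stacksLaw w E1 + stacksLaw w E2) + (stacksLaw w E3 + stacksLaw w E4)) +
        stacksLaw w E5 :=
      (measure_union_le _ _).trans (add_le_add ((measure_union_le _ _).trans
        (add_le_add (measure_union_le _ _) (measure_union_le _ _))) le_rfl)
    _ ≤ ((ENNReal.ofReal η + ENNReal.ofReal η) + (ENNReal.ofReal η + ENNReal.ofReal η)) + 0 := by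
      rw [p5]; gcongr
    _ = ENNReal.ofReal (4 * η) := by
      rw [add_zero, ← ENNReal.ofReal_add hη0.le hη0.le, ← ENNReal.ofReal_add (by linarith)
        (by linarith)]
      ring_nf
    _ ≤ ENNReal.ofReal d := ENNReal.ofReal_le_ofReal (by linarith [min_le_right (ε / 32) ((d : ℝ) / 4)])
    _ = d := ENNReal.ofReal_coe_nnreal
    _ ≤ δ := hdδ.le

lemma measurable_dirLocP (n : ℕ) (k : ℤ) : Measurable fun p : ℕ → ℤ => dirLocP p n k := by
  induction n with
  | zero => exact measurable_const
  | succ n ih =>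
    simp_rw [dirLocP_succ]
    exact ih.add (Measurable.ite ((measurableSet_eq_fun (measurable_pi_apply n)
      measurable_const).inter (measurableSet_eq_fun (measurable_pi_apply (n + 1))
      measurable_const)) measurable_const measurable_const)

lemma measurable_dirLocM (n : ℕ) (k : ℤ) : Measurable fun p : ℕ → ℤ => dirLocM p n k := by
  induction n with
  | zero => exact measurable_const
  | succ n ih =>
    simp_rw [dirLocM_succ]
    exact ih.add (Measurable.ite ((measurableSet_eq_fun (measurable_pi_apply n)
      measurable_const).inter (measurableSet_eq_fun (measurable_pi_apply (n + 1))
      measurable_const)) measurable_const measurable_const)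

lemma measurable_Tp (j : ℤ) (r : ℕ) : Measurable fun p : ℕ → ℤ => Tp p j r :=
  measurable_sInf_nat fun n => measurableSet_le measurable_const (measurable_dirLocP n j)

lemma measurable_Tm (j : ℤ) (r : ℕ) : Measurable fun p : ℕ → ℤ => Tm p j r :=
  measurable_sInf_nat fun n => measurableSet_le measurable_const (measurable_dirLocM n j)

/-- Events of a self-repelling walk have the probability of those of the stack walk. -/
lemma IsSRW.measure_eq_stacksLaw {w : ℤ → ℝ} (hw : ∀ z, 0 < w z) {Ω : Type*} [MeasurableSpace Ω]
    {μ : Measure Ω} [IsProbabilityMeasure μ] {X : ℕ → Ω → ℤ} (hX : IsSRW μ w X)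
    {F : (ℕ → ℤ) → ℕ} (hF : Measurable F) (Q : Set ℕ) :
    μ {ω | F (fun i => X i ω) ∈ Q} = stacksLaw w {σ | F (walkPos σ) ∈ Q} := by
  have hY := isSRW_walkPos hw
  have hm : MeasurableSet (F ⁻¹' Q) := hF trivial
  have h1 := congrArg (fun ρ => ρ (F ⁻¹' Q)) (hX.map_eq hY)
  rwa [Measure.map_apply (measurable_pi_lambda _ hX.1) hm,
    Measure.map_apply (measurable_pi_lambda _ hY.1) hm] at h1

/-- as `A → ∞`, `A⁻² T±_{⌊Ax⌋,⌊Ah⌋} → (|x| + 2h)²` in probability. -/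
theorem stmt_16 (w : ℤ → ℝ) (hw : GoodWeight w)
    {Ω : Type*} [MeasurableSpace Ω] (μ : Measure Ω) [IsProbabilityMeasure μ]
    (X : ℕ → Ω → ℤ) (hX : IsSRW μ w X) (x h : ℝ) (hh : 0 < h) :
    ∀ ε > (0 : ℝ),
      Tendsto (fun A : ℝ => μ {ω |
          ε < |(A ^ 2)⁻¹ * (Tp (fun i => X i ω) ⌊A * x⌋ (⌊A * h⌋).toNat : ℝ) -
            (|x| + 2 * h) ^ 2|}) atTop (𝓝 0) ∧
      Tendsto (fun A : ℝ => μ {ω |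
          ε < |(A ^ 2)⁻¹ * (Tm (fun i => X i ω) ⌊A * x⌋ (⌊A * h⌋).toNat : ℝ) -
            (|x| + 2 * h) ^ 2|}) atTop (𝓝 0) := by
  intro ε hε
  have hr0 : Tendsto (fun A : ℝ => ((⌊A * h⌋).toNat : ℝ) / A) atTop (𝓝 h) := by
    have := tendsto_toNat_div (c := fun A => ⌊A * h⌋) (y := h) (C := 1) fun A => by
      simpa using abs_floor_add_sub_le (A * h) 0
    rwa [max_eq_left hh.le] at this
  have hr1 : ∀ᶠ A : ℝ in atTop, 1 ≤ (⌊A * h⌋).toNat := by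
    filter_upwards [eventually_ge_atTop (1 / h)] with A hA
    have h1 : (1 : ℝ) ≤ A * h := by rwa [div_le_iff₀ hh] at hA
    have h2 : 1 ≤ ⌊A * h⌋ := Int.le_floor.2 (by exact_mod_cast h1)
    omega
  have hrd : ∀ (P : ℝ → Prop) [DecidablePred P], Tendsto
      (fun A : ℝ => (((⌊A * h⌋).toNat - if P A then 1 else 0 : ℕ) : ℝ) / A) atTop (𝓝 h) := by
    intro P _
    refine tendsto_div_of_abs_sub_le (C := 2) ?_
    filter_upwards [hr1, eventually_ge_atTop 0] with A hA h0
    have h1 := abs_toNat_sub_le h0 (y := h) (by simpa using abs_floor_add_sub_le (A * h) 0)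
    rw [max_eq_left hh.le, abs_le] at h1
    rw [Nat.cast_sub (by split_ifs <;> omega), abs_le]
    split_ifs <;> push_cast <;> constructor <;> linarith [h1.1, h1.2]
  have hneg : ∀ (d : ℤ) (A : ℝ),
      |((-(⌊A * x⌋ + d) - 1 : ℤ) : ℝ) - A * (-x)| ≤ 2 + |(d : ℝ)| := by
    intro d A
    have h1 := abs_floor_add_sub_le (A * x) d
    rw [abs_le] at h1 ⊢
    push_cast at h1 ⊢
    constructor <;> linarith [h1.1, h1.2]
  constructor
  · have key : ∀ A : ℝ, μ {ω |
          ε < |(A ^ 2)⁻¹ * (Tp (fun i => X i ω) ⌊A * x⌋ (⌊A * h⌋).toNat : ℝ) -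
            (|x| + 2 * h) ^ 2|} = stacksLaw w {σ |
          ε < |(A ^ 2)⁻¹ * (Tp (walkPos σ) ⌊A * x⌋ (⌊A * h⌋).toNat : ℝ) -
            (|x| + 2 * h) ^ 2|} := fun A =>
      hX.measure_eq_stacksLaw hw.1 (measurable_Tp ⌊A * x⌋ (⌊A * h⌋).toNat)
        {t | ε < |(A ^ 2)⁻¹ * (t : ℝ) - (|x| + 2 * h) ^ 2|}
    simp_rw [key]
    refine tendsto_measure_of_profile hw (c := fun A => ⌊A * x⌋) (l := fun A => (⌊A * h⌋).toNat)
      (r := fun A => (⌊A * h⌋).toNat - if 0 ≤ ⌊A * x⌋ then 1 else 0) hh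
      (tendsto_toNat_div (C := 1) fun A => by simpa using abs_floor_add_sub_le (A * x) 0)
      (tendsto_toNat_div (C := 2) fun A => by simpa using hneg 0 A) hr0 (hrd _) ?_ hε
    filter_upwards [hr1] with A hA σ h1 h2 K K' hK hK' h3 h4
    exact Tp_walkPos σ _ h1 h2 _ hA K K' hK hK' h3 h4
  · have key : ∀ A : ℝ, μ {ω |
          ε < |(A ^ 2)⁻¹ * (Tm (fun i => X i ω) ⌊A * x⌋ (⌊A * h⌋).toNat : ℝ) -
            (|x| + 2 * h) ^ 2|} = stacksLaw w {σ |
          ε < |(A ^ 2)⁻¹ * (Tm (walkPos σ) ⌊A * x⌋ (⌊A * h⌋).toNat : ℝ) -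
            (|x| + 2 * h) ^ 2|} := fun A =>
      hX.measure_eq_stacksLaw hw.1 (measurable_Tm ⌊A * x⌋ (⌊A * h⌋).toNat)
        {t | ε < |(A ^ 2)⁻¹ * (t : ℝ) - (|x| + 2 * h) ^ 2|}
    simp_rw [key]
    refine tendsto_measure_of_profile hw (c := fun A => ⌊A * x⌋ - 1)
      (l := fun A => (⌊A * h⌋).toNat - if ⌊A * x⌋ - 1 < 0 then 1 else 0)
      (r := fun A => (⌊A * h⌋).toNat) hh
      (tendsto_toNat_div (C := 1 + |((-1 : ℤ) : ℝ)|) fun A => abs_floor_add_sub_le (A * x) (-1))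
      (tendsto_toNat_div (C := 2 + |((-1 : ℤ) : ℝ)|) fun A => hneg (-1) A) (hrd _) hr0 ?_ hε
    filter_upwards [hr1] with A hA σ h1 h2 K K' hK hK' h3 h4
    exact Tm_walkPos σ _ h1 h2 _ hA K K' hK hK' h3 h4
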